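/- Let H : ℝ → ℝ be a Schwartz function, 0 ≠ k ∈ ℤ[ω], t ∈ ℝ, σ ≥ 1, and C > 0. Then for every ε > 0: | ∑_{c ∈ ℤ[ω], c ≡ 1 (mod 3)} g₃(k, c) N(c)^{−σ−it} H(N(c)/C) |² ≪_ε N(k)^ε · ∑_{w ∈ ℤ[ω], w ≡ 1 (mod 3), w ∣ k²} N(w)^{2−2σ} · | ∑_{n ∈ ℤ[ω], n ≡ 1 (mod 3)} μ(n)² conj(χ_n(kw)) g₃(n) N(n)^{−σ−it} H(N(wn)/C) |². -/

import Mathlib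

noncomputable section

open Complex

namespace CubicPaper

/-- `ω = e^{2πi/3}`. -/
def ωc : ℂ := Complex.exp (2 * Real.pi * Complex.I / 3)

/-- The ring of Eisenstein integers `ℤ[ω]`, realized as a subring of `ℂ`. -/
def Eis : Subring ℂ := Subring.closure {ωc}

/-- `ω` as an Eisenstein integer. -/
def ωE : Eis := ⟨ωc, Subring.subset_closure (Set.mem_singleton _)⟩

/-- The ramified prime `λ = 1 + 2ω`. -/
def lam : Eis := 1 + 2 * ωE

/-- The norm `N(x) = |x|²`. -/
def Nm (x : Eis) : ℝ := Complex.normSq (x : ℂ)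

/-- The norm as a natural number. -/
def NmN (x : Eis) : ℕ := ⌊Nm x⌋₊

/-- `Rep x` : `x` is the canonical generator `λ^k c`, `c ≡ 1 (mod 3)`, of a nonzero ideal;
nonzero ideals of `ℤ[ω]` are in bijection with elements satisfying `Rep`. -/
def Rep (x : Eis) : Prop := ∃ (k : ℕ) (c : Eis), (3 : Eis) ∣ (c - 1) ∧ x = lam ^ k * c

/-- `ě(z) = e^{2πi(z + z̄)}`. -/
def eE (z : ℂ) : ℂ := Complex.exp (2 * Real.pi * Complex.I * (z + (starRingEnd ℂ) z))

/-- Characterizing axioms of the cubic residue symbol; `χ b a` denotes `(a/b)₃`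
(the lower entry `b ≡ 1 (mod 3)` comes first). -/
structure IsCubicSymbol (χ : Eis → Eis → Eis) : Prop where
  one_bot : ∀ a, χ 1 a = 1
  mul_bot : ∀ b₁ b₂ a, (3 : Eis) ∣ (b₁ - 1) → (3 : Eis) ∣ (b₂ - 1) →
    χ (b₁ * b₂) a = χ b₁ a * χ b₂ a
  prime_vals : ∀ π a, Prime π → (3 : Eis) ∣ (π - 1) →
    χ π a = 0 ∨ χ π a = 1 ∨ χ π a = ωE ∨ χ π a = ωE ^ 2
  prime_congr : ∀ π a, Prime π → (3 : Eis) ∣ (π - 1) →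
    π ∣ (a ^ ((NmN π - 1) / 3) - χ π a)
  prime_eq_zero : ∀ π a, Prime π → (3 : Eis) ∣ (π - 1) → (χ π a = 0 ↔ π ∣ a)

/-- Characterizing axioms of the Möbius function on `ℤ[ω]`. -/
structure IsMoebius (μ : Eis → ℤ) : Prop where
  isUnit : ∀ u : Eis, IsUnit u → μ u = 1
  prime_mul : ∀ p x, Prime p → ¬ p ∣ x → μ (p * x) = - μ x
  eq_zero : ∀ x : Eis, ¬ Squarefree x → μ x = 0

/-- The cubic Gauss sum `g₃(m, c) = ∑_{d mod c} χ_c(d) ě(md/c)`. -/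
def g₃ (χ : Eis → Eis → Eis) (m c : Eis) : ℂ :=
  ∑ᶠ d : Eis ⧸ Ideal.span {c}, ((χ c d.out : Eis) : ℂ) * eE (((m * d.out : Eis) : ℂ) / (c : ℂ))

/-- The normalized cubic Gauss sum `g̃₃(m, c) = N(c)^{-1/2} g₃(m, c)`. -/
def g₃n (χ : Eis → Eis → Eis) (m c : Eis) : ℂ :=
  ((Real.sqrt (Nm c) : ℂ))⁻¹ * g₃ χ m c

/-- Euler's totient on `ℤ[ω]`. -/
def phiE (b : Eis) : ℕ := Nat.card {x : Eis ⧸ Ideal.span {b} // IsUnit x}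

/-- The kernel `Φ_j(y) = (1/2πi)∫_{(2)} (2π)^{-jw} y^{-w} (Γ(1/2+w)/Γ(1/2))^j dw/w`. -/
def Φ (j : ℕ) (y : ℝ) : ℂ :=
  (1 / (2 * Real.pi)) * ∫ t : ℝ,
    (2 * Real.pi : ℂ) ^ (-((j : ℂ) * (2 + t * Complex.I))) *
    (y : ℂ) ^ (-(2 + t * Complex.I)) *
    (Complex.Gamma (1 / 2 + (2 + t * Complex.I)) / Complex.Gamma (1 / 2)) ^ j /
    (2 + t * Complex.I)

/-- `A₁(q)`, the sum appearing in the approximate functional equation for `L(1/2, χ_q)`. -/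
def A₁ (χ : Eis → Eis → Eis) (q : Eis) : ℂ :=
  ∑' n : {x : Eis // Rep x},
    ((χ q n.1 : Eis) : ℂ) * (Nm n.1 : ℂ) ^ (-(1/2 : ℂ)) *
      Φ 1 (Nm n.1 / Real.sqrt (3 * Nm q))

/-- `A₂(q)`, the double sum appearing in the approximate functional equation for
`|L(1/2, χ_q)|²`. -/
def A₂ (χ : Eis → Eis → Eis) (q : Eis) : ℂ :=
  ∑' p : {x : Eis // Rep x} × {x : Eis // Rep x},
    ((χ q p.1.1 : Eis) : ℂ) * (starRingEnd ℂ) ((χ q p.2.1 : Eis) : ℂ) *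
      ((Nm p.1.1 * Nm p.2.1 : ℝ) : ℂ) ^ (-(1/2 : ℂ)) *
      Φ 2 (Nm p.1.1 * Nm p.2.1 / (3 * Nm q))

/-- `M_Y(q) = ∑_{𝔩² ∣ q, N(𝔩) ≤ Y} μ(𝔩)` (sum over nonzero ideals `𝔩`, i.e. over
canonical generators). -/
def MY (μ : Eis → ℤ) (Y : ℝ) (q : Eis) : ℤ :=
  ∑ᶠ l ∈ {l : Eis | Rep l ∧ l ^ 2 ∣ q ∧ Nm l ≤ Y}, μ l

/-- `R_Y(q) = ∑_{𝔩² ∣ q, N(𝔩) > Y} μ(𝔩)`. -/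
def RY (μ : Eis → ℤ) (Y : ℝ) (q : Eis) : ℤ :=
  ∑ᶠ l ∈ {l : Eis | Rep l ∧ l ^ 2 ∣ q ∧ Y < Nm l}, μ l

/-- The mollifier `𝓜(q) = ∑_𝔟 λ(𝔟) √N(𝔟) χ_q(𝔟)` attached to coefficients `lm`
(supported on canonical generators of squarefree ideals coprime to 3). -/
def Moll (χ : Eis → Eis → Eis) (lm : Eis → ℂ) (q : Eis) : ℂ :=
  ∑ᶠ b : Eis, lm b * (Real.sqrt (Nm b) : ℂ) * ((χ q b : Eis) : ℂ)

/-- `𝒮_M(β; F) = ∑_{q ≡ 1 (9)} M_Y(q) β_q F(N(q)/X)`. -/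
def SM (μ : Eis → ℤ) (Y X : ℝ) (F : ℝ → ℝ) (β : Eis → ℂ) : ℂ :=
  ∑ᶠ q ∈ {q : Eis | (9 : Eis) ∣ (q - 1)}, (MY μ Y q : ℂ) * β q * (F (Nm q / X) : ℂ)

/-- `𝒮_R(|β|; F) = ∑_{q ≡ 1 (9)} |R_Y(q)| ‖β_q‖ F(N(q)/X)`. -/
def SR (μ : Eis → ℤ) (Y X : ℝ) (F : ℝ → ℝ) (β : Eis → ℂ) : ℝ :=
  ∑ᶠ q ∈ {q : Eis | (9 : Eis) ∣ (q - 1)}, |(RY μ Y q : ℝ)| * ‖β q‖ * F (Nm q / X)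

/-- A test function: Schwartz (here: smooth), compactly supported in `(1,2)`,
with `0 ≤ F ≤ 1`. -/
structure IsTestFn (F : ℝ → ℝ) : Prop where
  smooth : ContDiff ℝ (⊤ : ℕ∞) F
  supp : ∀ t, F t ≠ 0 → 1 < t ∧ t < 2
  nonneg : ∀ t, 0 ≤ F t
  le_one : ∀ t, F t ≤ 1

/-- `F̌(0) = ∫₀^∞ F(t) dt`. -/
def Fcheck0 (F : ℝ → ℝ) : ℝ := ∫ t in Set.Ioi (0:ℝ), F t

/-- `F̌'(0) = ∫₀^∞ F(t) log t dt`. -/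
def Fcheck'0 (F : ℝ → ℝ) : ℝ := ∫ t in Set.Ioi (0:ℝ), F t * Real.log t

/-- The Dedekind zeta function of `ℚ(ω)` (at real `s > 1`). -/
def zetaK (s : ℝ) : ℝ := ∑' n : {x : Eis // Rep x}, (Nm n.1) ^ (-s)

/-- Product of `f(N(𝔭))` over the prime ideals `𝔭 ∤ 3` of `ℤ[ω]`, i.e. over primes
`π ≡ 1 (mod 3)` (one in each associate class). -/
def primeProd (f : ℝ → ℝ) : ℝ :=
  ∏' π : {p : Eis // Prime p ∧ (3 : Eis) ∣ (p - 1)}, f (Nm π.1)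

/-- Product of `f(N(𝔭))` over the prime ideals `𝔭 ∤ 3` dividing `x` (a finite product). -/
def primeDivProd (f : ℝ → ℝ) (x : Eis) : ℝ :=
  ∏ᶠ π ∈ {p : Eis | Prime p ∧ (3 : Eis) ∣ (p - 1) ∧ p ∣ x}, f (Nm π)

/-- The Hecke `L`-series `∑_𝔫 χ_q(𝔫) N(𝔫)^{-s}` (convergent for `Re(s) > 1`). -/
def heckeSeries (χ : Eis → Eis → Eis) (q : Eis) (s : ℂ) : ℂ :=
  ∑' n : {x : Eis // Rep x}, ((χ q n.1 : Eis) : ℂ) * (Nm n.1 : ℂ) ^ (-s)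

/-- `L` is the (unique) entire continuation of the Hecke `L`-series of `χ_q`. -/
def IsHeckeL (χ : Eis → Eis → Eis) (q : Eis) (L : ℂ → ℂ) : Prop :=
  Differentiable ℂ L ∧ ∀ s : ℂ, 1 < s.re → L s = heckeSeries χ q s

/-- Membership in the family `F₃` of conductors of primitive cubic Hecke characters
congruent to `1 (mod 9)`. -/
def memF₃ (q : Eis) : Prop :=
  ∃ q₁ q₂ : Eis, (3 : Eis) ∣ (q₁ - 1) ∧ (3 : Eis) ∣ (q₂ - 1) ∧ Squarefree (q₁ * q₂) ∧
    NmN (q₁ * q₂ ^ 2) % 9 = 1 ∧ q = q₁ * q₂ ^ 2 ∧ (9 : Eis) ∣ (q - 1) ∧ q ≠ 1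

/-- `ψ_α(r, s) = ∑_{c ≡ 1 (3), (c, α) = 1} g₃(r, c) N(c)^{-s}`. -/
def ψa (χ : Eis → Eis → Eis) (α r : Eis) (s : ℂ) : ℂ :=
  ∑' c : {c : Eis // (3 : Eis) ∣ (c - 1) ∧ IsCoprime c α},
    g₃ χ r c.1 * (Nm c.1 : ℂ) ^ (-s)

/-- `ψ(r, s) = ∑_{c ≡ 1 (3)} g₃(r, c) N(c)^{-s}`. -/
def ψ₀ (χ : Eis → Eis → Eis) (r : Eis) (s : ℂ) : ℂ :=
  ∑' c : {c : Eis // (3 : Eis) ∣ (c - 1)}, g₃ χ r c.1 * (Nm c.1 : ℂ) ^ (-s)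

/-- `Δ_α(s) = ∏_{π ≡ 1 (3) prime, π ∣ α} (1 - N(π)^{2-3s})`. -/
def Δprod (α : Eis) (s : ℂ) : ℂ :=
  ∏ᶠ π ∈ {p : Eis | Prime p ∧ (3 : Eis) ∣ (p - 1) ∧ p ∣ α},
    (1 - (Nm π : ℂ) ^ ((2 : ℂ) - 3 * s))

/-- `Ψ` is the (unique) continuation of `ψ(r, ·)` to the strip `1 < Re(s) < 2`,
holomorphic away from `s = 4/3`. -/
def IsPsiContinuation (χ : Eis → Eis → Eis) (r : Eis) (Ψ : ℂ → ℂ) : Prop :=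
  (∀ s : ℂ, 1 < s.re → s.re < 2 → s ≠ 4/3 → DifferentiableAt ℂ Ψ s) ∧
  (∀ s : ℂ, 3/2 < s.re → s.re < 2 → Ψ s = ψ₀ χ r s)


/-! ### Basic structure of the Eisenstein integers -/

lemma ωc_prim : IsPrimitiveRoot ωc 3 := by
  have := Complex.isPrimitiveRoot_exp 3 (by norm_num)
  simpa [ωc] using this

lemma ωc_sq : ωc ^ 2 = -1 - ωc := by
  have h := ωc_prim.geom_sum_eq_zero (by norm_num)
  simp [Finset.sum_range_succ] at h
  linear_combination h

lemma ωc_conj : (starRingEnd ℂ) ωc = -1 - ωc := by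
  have h1 : ‖ωc‖ = 1 := ωc_prim.norm'_eq_one (by norm_num)
  have h2 : ωc * (starRingEnd ℂ) ωc = 1 := by
    rw [Complex.mul_conj, Complex.normSq_eq_norm_sq, h1]; norm_num
  have h3 : ωc ≠ 0 := by
    intro h; rw [h] at h1; simp at h1
  apply mul_left_cancel₀ h3
  rw [h2]
  linear_combination ωc_sq

lemma ωE_coe : ((ωE : Eis) : ℂ) = ωc := rfl

lemma ωE_sq : ωE ^ 2 = -1 - ωE := by
  apply Subtype.ext
  push_cast
  rw [ωE_coe, ωc_sq]

lemma ωE_cube : ωE ^ 3 = 1 := by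
  linear_combination (ωE - 1) * ωE_sq

lemma coords (x : Eis) : ∃ a b : ℤ, x = (a : Eis) + (b : Eis) * ωE := by
  obtain ⟨x, hx⟩ := x
  suffices h : ∃ a b : ℤ, x = (a : ℂ) + (b : ℂ) * ωc by
    obtain ⟨a, b, h⟩ := h
    refine ⟨a, b, Subtype.ext ?_⟩
    push_cast
    rw [ωE_coe, h]
  refine Subring.closure_induction (p := fun x _ => ∃ a b : ℤ, x = (a : ℂ) + (b : ℂ) * ωc)
    ?_ ?_ ?_ ?_ ?_ ?_ hx
  · intro y hy
    rw [Set.mem_singleton_iff] at hy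
    exact ⟨0, 1, by simp [hy]⟩
  · exact ⟨0, 0, by simp⟩
  · exact ⟨1, 0, by simp⟩
  · rintro y z _ _ ⟨a, b, rfl⟩ ⟨c, d, rfl⟩
    exact ⟨a + c, b + d, by push_cast; ring⟩
  · rintro y _ ⟨a, b, rfl⟩
    exact ⟨-a, -b, by push_cast; ring⟩
  · rintro y z _ _ ⟨a, b, rfl⟩ ⟨c, d, rfl⟩
    refine ⟨a * c - b * d, a * d + b * c - b * d, ?_⟩
    push_cast
    linear_combination (b * d : ℂ) * ωc_sq

/-- complex conjugation on the Eisenstein integers -/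
def conjE : Eis →+* Eis where
  toFun x := ⟨(starRingEnd ℂ) (x : ℂ), by
    obtain ⟨a, b, h⟩ := coords x
    have h2 : (starRingEnd ℂ) (x : ℂ) = (((a : Eis) + (b : Eis) * (-1 - ωE) : Eis) : ℂ) := by
      rw [h]; push_cast; simp [ωE_coe, ωc_conj]
    rw [h2]; exact Subtype.property _⟩
  map_one' := by apply Subtype.ext; simp
  map_mul' x y := by apply Subtype.ext; simp
  map_zero' := by apply Subtype.ext; simp
  map_add' x y := by apply Subtype.ext; simp

lemma conjE_coe (x : Eis) : ((conjE x : Eis) : ℂ) = (starRingEnd ℂ) (x : ℂ) := rfl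

lemma conjE_conjE (x : Eis) : conjE (conjE x) = x := by
  apply Subtype.ext; simp [conjE_coe]

lemma conjE_ω : conjE ωE = -1 - ωE := by
  apply Subtype.ext
  rw [conjE_coe, ωE_coe, ωc_conj]; push_cast; rw [ωE_coe]

lemma conjE_ω' : conjE ωE = ωE ^ 2 := by rw [conjE_ω, ωE_sq]

lemma Nm_coords (a b : ℤ) : Nm ((a : Eis) + (b : Eis) * ωE) = ((a ^ 2 - a * b + b ^ 2 : ℤ) : ℝ) := by
  have : ((Nm ((a : Eis) + (b : Eis) * ωE) : ℝ) : ℂ) = ((a ^ 2 - a * b + b ^ 2 : ℤ) : ℂ) := by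
    rw [Nm, ← Complex.mul_conj]
    push_cast
    simp only [ωE_coe, map_add, map_mul, ωc_conj, map_intCast]
    linear_combination (-(b : ℂ) ^ 2) * ωc_sq
  exact_mod_cast this

lemma NmN_cast (x : Eis) : ((NmN x : ℕ) : ℝ) = Nm x := by
  obtain ⟨a, b, rfl⟩ := coords x
  have h0 : 0 ≤ a ^ 2 - a * b + b ^ 2 := by nlinarith [sq_nonneg (a - b), sq_nonneg (a + b)]
  obtain ⟨n, hn⟩ := Int.eq_ofNat_of_zero_le h0
  rw [NmN, Nm_coords, hn]
  simp

lemma Nm_mul (x y : Eis) : Nm (x * y) = Nm x * Nm y := by simp [Nm]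

lemma NmN_mul (x y : Eis) : NmN (x * y) = NmN x * NmN y := by
  have : ((NmN (x * y) : ℕ) : ℝ) = ((NmN x * NmN y : ℕ) : ℝ) := by
    push_cast; simp [NmN_cast, Nm_mul]
  exact_mod_cast this

lemma Nm_nonneg (x : Eis) : 0 ≤ Nm x := Complex.normSq_nonneg _

lemma Nm_eq_zero {x : Eis} : Nm x = 0 ↔ x = 0 := by simp [Nm]

lemma NmN_eq_zero {x : Eis} : NmN x = 0 ↔ x = 0 := by
  rw [← Nm_eq_zero, ← NmN_cast]; simp

lemma NmN_pos {x : Eis} (h : x ≠ 0) : 0 < NmN x :=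
  Nat.pos_of_ne_zero (fun h' => h (NmN_eq_zero.1 h'))

lemma Nm_pos {x : Eis} (h : x ≠ 0) : 0 < Nm x := by
  rw [← NmN_cast]; exact_mod_cast NmN_pos h

lemma NmN_coords (a b : ℤ) :
    ((NmN ((a : Eis) + (b : Eis) * ωE) : ℕ) : ℤ) = a ^ 2 - a * b + b ^ 2 := by
  have := NmN_cast ((a : Eis) + (b : Eis) * ωE)
  rw [Nm_coords] at this
  exact_mod_cast this

lemma mul_conjE (x : Eis) : x * conjE x = ((NmN x : ℕ) : Eis) := by
  apply Subtype.ext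
  push_cast
  rw [conjE_coe, Complex.mul_conj, show Complex.normSq (x : ℂ) = Nm x from rfl, ← NmN_cast]
  simp

lemma NmN_one : NmN 1 = 1 := by simp [NmN, Nm]

lemma NmN_conjE (x : Eis) : NmN (conjE x) = NmN x := by simp [NmN, Nm, conjE_coe]

lemma isUnit_iff_NmN {x : Eis} : IsUnit x ↔ NmN x = 1 := by
  constructor
  · rintro ⟨u, rfl⟩
    have : NmN (u : Eis) * NmN ((u⁻¹ : Eisˣ) : Eis) = 1 := by
      rw [← NmN_mul]; simp [NmN_one]
    exact Nat.eq_one_of_mul_eq_one_right this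
  · intro h
    have := mul_conjE x
    rw [h, Nat.cast_one] at this
    exact IsUnit.of_mul_eq_one _ this

lemma exists_div (a b : Eis) (hb : b ≠ 0) : ∃ q : Eis, NmN (a - b * q) < NmN b := by
  obtain ⟨u, v, huv⟩ := coords (a * conjE b)
  have hN : (0 : ℝ) < Nm b := Nm_pos hb
  set N : ℝ := Nm b with hNdef
  set r : ℤ := round ((u : ℝ) / N)
  set s : ℤ := round ((v : ℝ) / N)
  refine ⟨(r : Eis) + (s : Eis) * ωE, ?_⟩
  have hr : |(u : ℝ) / N - r| ≤ 1 / 2 := abs_sub_round _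
  have hs : |(v : ℝ) / N - s| ≤ 1 / 2 := abs_sub_round _
  have key : NmN ((a - b * ((r : Eis) + (s : Eis) * ωE)) * conjE b) < NmN b * NmN b := by
    have h1 : (a - b * ((r : Eis) + (s : Eis) * ωE)) * conjE b
        = ((u - r * (NmN b : ℕ) : ℤ) : Eis) + ((v - s * (NmN b : ℕ) : ℤ) : Eis) * ωE := by
      push_cast
      linear_combination huv - ((r : Eis) + (s : Eis) * ωE) * mul_conjE b
    rw [h1]
    have h2 := Nm_coords (u - r * (NmN b : ℕ)) (v - s * (NmN b : ℕ))
    rw [← NmN_cast] at h2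
    have h3 : ((NmN b * NmN b : ℕ) : ℝ) = N * N := by push_cast; rw [NmN_cast]
    rw [← @Nat.cast_lt ℝ, h2, h3]
    push_cast
    rw [NmN_cast, ← hNdef]
    have e1 : (u : ℝ) - r * N = ((u : ℝ) / N - r) * N := by field_simp
    have e2 : (v : ℝ) - s * N = ((v : ℝ) / N - s) * N := by field_simp
    rw [e1, e2]
    rw [abs_le] at hr hs
    set α := (u : ℝ) / N - r
    set β := (v : ℝ) / N - s
    have : α ^ 2 - α * β + β ^ 2 < 1 := by nlinarith
    nlinarith [mul_pos hN hN]
  rw [NmN_mul, NmN_conjE] at key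
  exact lt_of_mul_lt_mul_right key (Nat.zero_le _)

open Classical in
/-- The Euclidean domain structure on the Eisenstein integers. -/
@[reducible] def eisED : EuclideanDomain Eis :=
  { (inferInstance : CommRing Eis), (inferInstance : Nontrivial Eis) with
    quotient := fun a b => if h : b = 0 then 0 else Classical.choose (exists_div a b h)
    quotient_zero := fun a => by simp
    remainder := fun a b => a - b * (if h : b = 0 then 0 else Classical.choose (exists_div a b h))
    quotient_mul_add_remainder_eq := fun a b => by ring
    r := fun a b => NmN a < NmN b
    r_wellFounded := (measure NmN).wf
    remainder_lt := fun a b hb => by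
      simp only [hb, dif_neg, not_false_eq_true]
      exact Classical.choose_spec (exists_div a b hb)
    mul_left_not_lt := fun a b hb => by
      rw [NmN_mul, not_lt]
      exact Nat.le_mul_of_pos_right _ (NmN_pos hb) }

instance eisPID : IsPrincipalIdealRing Eis :=
  @EuclideanDomain.to_principal_ideal_domain Eis eisED

lemma coords_inj {a b c d : ℤ} (h : (a : Eis) + (b : Eis) * ωE = (c : Eis) + (d : Eis) * ωE) :
    a = c ∧ b = d := by
  have h0 : ((a - c : ℤ) : Eis) + ((b - d : ℤ) : Eis) * ωE = 0 := by
    push_cast; linear_combination h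
  have h1 := NmN_coords (a - c) (b - d)
  rw [h0, NmN_eq_zero.2 rfl] at h1
  have h2 : b - d = 0 := by
    have : (b - d) ^ 2 ≤ 0 := by
      push_cast at h1; nlinarith [sq_nonneg (2 * (a - c) - (b - d))]
    exact pow_eq_zero_iff (two_ne_zero) |>.1 (le_antisymm this (sq_nonneg _))
  have h3 : a - c = 0 := by
    rw [h2] at h1
    have : (a - c) ^ 2 = 0 := by push_cast at h1; linarith
    exact pow_eq_zero_iff (two_ne_zero) |>.1 this
  exact ⟨by linarith, by linarith⟩

/-- The basis `1, ω`. -/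
def eisBasis : Module.Basis (Fin 2) ℤ Eis :=
  Module.Basis.mk (v := ![(1 : Eis), ωE])
    (by
      rw [LinearIndependent.pair_iff]
      intro s t h
      have : (s : Eis) + (t : Eis) * ωE = ((0 : ℤ) : Eis) + ((0 : ℤ) : Eis) * ωE := by
        simpa using h
      exact coords_inj this)
    (by
      rintro x -
      obtain ⟨a, b, rfl⟩ := coords x
      have h1 : (1 : Eis) ∈ Submodule.span ℤ (Set.range ![(1 : Eis), ωE]) :=
        Submodule.subset_span ⟨0, rfl⟩
      have h2 : ωE ∈ Submodule.span ℤ (Set.range ![(1 : Eis), ωE]) :=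
        Submodule.subset_span ⟨1, rfl⟩
      have := Submodule.add_mem _ (Submodule.smul_mem _ a h1) (Submodule.smul_mem _ b h2)
      simpa using this)

instance : Module.Free ℤ Eis := Module.Free.of_basis eisBasis
instance : Module.Finite ℤ Eis := Module.Finite.of_basis eisBasis

lemma eisBasis_zero : eisBasis 0 = 1 := by simp [eisBasis]
lemma eisBasis_one : eisBasis 1 = ωE := by simp [eisBasis]

lemma eisBasis_repr (a b : ℤ) : ⇑(eisBasis.repr ((a : Eis) + (b : Eis) * ωE)) = ![a, b] := by
  have : (a : Eis) + (b : Eis) * ωE = ∑ i, (![a, b] i) • eisBasis i := by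
    simp [Fin.sum_univ_two, eisBasis_zero, eisBasis_one]
  rw [this, eisBasis.repr_sum_self]

lemma algNorm_eq (x : Eis) : Algebra.norm ℤ x = ((NmN x : ℕ) : ℤ) := by
  obtain ⟨a, b, rfl⟩ := coords x
  rw [NmN_coords, Algebra.norm_eq_matrix_det eisBasis, Matrix.det_fin_two]
  simp only [Algebra.leftMulMatrix_eq_repr_mul, eisBasis_zero, eisBasis_one]
  have e : ((a : Eis) + (b : Eis) * ωE) * ωE = ((-b : ℤ) : Eis) + ((a - b : ℤ) : Eis) * ωE := by
    push_cast
    linear_combination (b : Eis) * ωE_sq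
  rw [mul_one, e, eisBasis_repr, eisBasis_repr]
  simp
  ring

lemma card_quot (c : Eis) : Nat.card (Eis ⧸ Ideal.span {c}) = NmN c := by
  rw [← Submodule.cardQuot_apply, ← Ideal.absNorm_apply, Ideal.absNorm_span_singleton, algNorm_eq]
  simp

lemma finite_quot {c : Eis} (hc : c ≠ 0) : Finite (Eis ⧸ Ideal.span {c}) := by
  apply Nat.finite_of_card_ne_zero
  rw [card_quot]
  exact Nat.ne_of_gt (NmN_pos hc)

/-! ### Primary elements -/

/-- primary: congruent to `1` modulo `3` -/
abbrev Pr (x : Eis) : Prop := (3 : Eis) ∣ (x - 1)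

lemma Pr_one : Pr 1 := ⟨0, by ring⟩

lemma Pr.mul {x y : Eis} (hx : Pr x) (hy : Pr y) : Pr (x * y) := by
  obtain ⟨a, ha⟩ := hx
  obtain ⟨b, hb⟩ := hy
  exact ⟨a * y + b, by linear_combination y * ha + hb⟩

lemma Pr.of_mul {x y : Eis} (hx : Pr x) (hxy : Pr (x * y)) : Pr y := by
  obtain ⟨a, ha⟩ := hx
  obtain ⟨b, hb⟩ := hxy
  exact ⟨b - a * y, by linear_combination hb - y * ha⟩

lemma Pr.conj {x : Eis} (hx : Pr x) : Pr (conjE x) := by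
  obtain ⟨a, ha⟩ := hx
  refine ⟨conjE a, ?_⟩
  have := congrArg conjE ha
  rw [map_sub, map_one, map_mul, map_ofNat] at this
  exact this

lemma Pr.coords {x : Eis} (hx : Pr x) :
    ∃ c d : ℤ, x = ((1 + 3 * c : ℤ) : Eis) + ((3 * d : ℤ) : Eis) * ωE := by
  obtain ⟨y, hy⟩ := hx
  obtain ⟨c, d, rfl⟩ := CubicPaper.coords y
  refine ⟨c, d, ?_⟩
  push_cast
  linear_combination hy

lemma Pr.NmN_mod {x : Eis} (hx : Pr x) : NmN x % 3 = 1 := by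
  obtain ⟨c, d, rfl⟩ := hx.coords
  have h := NmN_coords (1 + 3 * c) (3 * d)
  have : (1 + 3 * c) ^ 2 - (1 + 3 * c) * (3 * d) + (3 * d) ^ 2
    = 1 + 3 * (2 * c + 3 * c ^ 2 - (1 + 3 * c) * d + 3 * d ^ 2) := by ring
  rw [this] at h
  omega

lemma Pr.ne_zero {x : Eis} (hx : Pr x) : x ≠ 0 := by
  rintro rfl
  have := hx.NmN_mod
  rw [NmN_eq_zero.2 rfl] at this
  omega

lemma lam_sq : lam ^ 2 = -3 := by
  unfold lam
  linear_combination 4 * ωE_sq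

lemma NmN_lam : NmN lam = 3 := by
  have := NmN_coords 1 2
  rw [show ((1 : ℤ) : Eis) + ((2 : ℤ) : Eis) * ωE = lam by simp [lam]] at this
  omega

lemma NmN_three : NmN 3 = 9 := by
  have := NmN_coords 3 0
  rw [show ((3 : ℤ) : Eis) + ((0 : ℤ) : Eis) * ωE = 3 by simp] at this
  omega

lemma NmN_dvd {x y : Eis} (h : x ∣ y) : NmN x ∣ NmN y := by
  obtain ⟨z, rfl⟩ := h
  exact ⟨NmN z, NmN_mul x z⟩

lemma Pr.not_lam_dvd {x : Eis} (hx : Pr x) : ¬ lam ∣ x := by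
  intro h
  have h1 := NmN_dvd h
  rw [NmN_lam] at h1
  have := hx.NmN_mod
  omega

lemma isUnit_ω : IsUnit ωE :=
  IsUnit.of_mul_eq_one (ωE ^ 2) (by rw [← ωE_cube]; ring)

lemma exists_unit_mul_Pr {x : Eis} (hx : ¬ lam ∣ x) : ∃ u : Eis, IsUnit u ∧ Pr (u * x) := by
  obtain ⟨a, b, rfl⟩ := coords x
  have hl3 : ∀ y : Eis, lam ∣ 3 * y := fun y => ⟨-lam * y, by linear_combination y * lam_sq⟩
  have ha := Int.emod_add_mul_ediv a 3
  have hb := Int.emod_add_mul_ediv b 3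
  set a' := a / 3
  set b' := b / 3
  have ha3 : a % 3 = 0 ∨ a % 3 = 1 ∨ a % 3 = 2 := by omega
  have hb3 : b % 3 = 0 ∨ b % 3 = 1 ∨ b % 3 = 2 := by omega
  have hw := isUnit_ω
  have hw2 := hw.pow 2
  have e0 := ωE_sq
  have e1 := ωE_cube
  rcases ha3 with h | h | h <;> rcases hb3 with h' | h' | h' <;> rw [h] at ha <;>
    rw [h'] at hb <;> rw [← ha, ← hb] at hx ⊢ <;> push_cast at hx ⊢
  · refine absurd ?_ hx
    have := hl3 ((a' : Eis) + b' * ωE)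
    convert this using 1; ring
  · exact ⟨_, hw2, (a' : Eis) * ωE ^ 2 + b', by linear_combination (1 + 3 * b') * e1⟩
  · exact ⟨_, hw2.neg, -((a' : Eis) * ωE ^ 2 + b') - 1,
      by linear_combination -(2 + 3 * b') * e1⟩
  · exact ⟨1, isUnit_one, (a' : Eis) + b' * ωE, by ring⟩
  · exact ⟨_, hw.neg, -(a' : Eis) * ωE - b' * ωE ^ 2, by linear_combination -e0⟩
  · refine absurd ?_ hx
    have := dvd_add (hl3 ((a' : Eis) + b' * ωE)) (dvd_refl lam)
    convert this using 1
    unfold lam; ring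
  · exact ⟨_, isUnit_one.neg, -((a' : Eis) + b' * ωE) - 1, by ring⟩
  · refine absurd ?_ hx
    have := dvd_sub (hl3 ((a' : Eis) + b' * ωE + 1 + ωE)) (dvd_refl lam)
    convert this using 1
    unfold lam; ring
  · exact ⟨_, hw, (a' : Eis) * ωE + b' * ωE ^ 2 - 1, by linear_combination 2 * e0⟩

lemma Pr.unit_eq_one {u x : Eis} (hu : IsUnit u) (hx : Pr x) (hux : Pr (u * x)) : u = 1 := by
  have h3 : Pr u := by
    rw [mul_comm] at hux
    exact hx.of_mul hux
  have h1 := NmN_dvd h3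
  rw [NmN_three] at h1
  obtain ⟨a, b, rfl⟩ := CubicPaper.coords u
  have h2 := NmN_coords a b
  rw [isUnit_iff_NmN.1 hu] at h2
  have h4 := NmN_coords (a - 1) b
  have e : ((a - 1 : ℤ) : Eis) + (b : Eis) * ωE = (a : Eis) + b * ωE - 1 := by push_cast; ring
  rw [e] at h4
  have h5 : ((NmN ((a : Eis) + b * ωE - 1) : ℕ) : ℤ) < 9 := by
    rw [h4]
    have : (a - 1) ^ 2 - (a - 1) * b + b ^ 2 = 2 - 2 * a + b := by push_cast at h2; linarith
    rw [this]
    push_cast at h2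
    nlinarith [sq_nonneg (2 * a - b + 4), sq_nonneg b, sq_nonneg (2 * a - b)]
  have h6 : NmN ((a : Eis) + b * ωE - 1) = 0 := by
    apply Nat.eq_zero_of_dvd_of_lt h1; omega
  rw [NmN_eq_zero] at h6
  linear_combination h6

lemma Pr.eq_of_associated {x y : Eis} (hx : Pr x) (hy : Pr y) (h : Associated x y) : x = y := by
  obtain ⟨u, rfl⟩ := h
  rw [mul_comm] at hy ⊢
  rw [Pr.unit_eq_one u.isUnit hx hy, one_mul]

/-- Associated primary prime factor. -/
lemma Pr.exists_prime {b : Eis} (hb : Pr b) (hb1 : b ≠ 1) :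
    ∃ π c, Prime π ∧ Pr π ∧ Pr c ∧ b = π * c := by
  have hnu : ¬ IsUnit b := fun h => hb1 (by
    have := Pr.unit_eq_one h Pr_one (by simpa using hb)
    exact this)
  obtain ⟨p, hp, hpb⟩ := WfDvdMonoid.exists_irreducible_factor hnu hb.ne_zero
  have hl : ¬ lam ∣ p := fun h => hb.not_lam_dvd (h.trans hpb)
  obtain ⟨u, hu, hup⟩ := exists_unit_mul_Pr hl
  have hass : Associated p (u * p) := by
    obtain ⟨v, rfl⟩ := hu
    exact ⟨v, mul_comm _ _⟩
  have hd : u * p ∣ b := hass.dvd_iff_dvd_left.1 hpb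
  obtain ⟨c, rfl⟩ := hd
  exact ⟨u * p, c, hass.prime_iff.1 hp.prime, hup, hup.of_mul hb, rfl⟩

lemma prime_one_lt_NmN {p : Eis} (hp : Prime p) : 1 < NmN p := by
  have h0 := NmN_pos hp.ne_zero
  have h1 : NmN p ≠ 1 := fun h => hp.not_isUnit (isUnit_iff_NmN.2 h)
  omega

theorem pr_induction {P : Eis → Prop} (h1 : P 1)
    (hm : ∀ π b, Prime π → Pr π → Pr b → P b → P (π * b)) (b : Eis) (hb : Pr b) : P b := by
  induction hn : NmN b using Nat.strong_induction_on generalizing b with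
  | _ n ih =>
    by_cases hb1 : b = 1
    · rwa [hb1]
    obtain ⟨π, c, hπ, hpπ, hc, rfl⟩ := hb.exists_prime hb1
    refine hm π c hπ hpπ hc (ih (NmN c) ?_ c hc rfl)
    rw [← hn, NmN_mul]
    have := prime_one_lt_NmN hπ
    have := NmN_pos hc.ne_zero
    nlinarith

/-! ### Values of the cubic symbol -/

/-- the set of possible values -/
def Cz (s : Eis) : Prop := s = 0 ∨ s = 1 ∨ s = ωE ∨ s = ωE ^ 2

lemma Cz.mul {s t : Eis} (hs : Cz s) (ht : Cz t) : Cz (s * t) := by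
  have e1 := ωE_cube
  have e4 : ωE ^ 2 * ωE ^ 2 = ωE := by linear_combination ωE * e1
  have e5 : ωE ^ 2 * ωE = 1 := by linear_combination e1
  have e6 : ωE * ωE ^ 2 = 1 := by linear_combination e1
  rcases hs with rfl | rfl | rfl | rfl <;> rcases ht with rfl | rfl | rfl | rfl <;>
    simp [Cz, e4, e5, e6, ← pow_two]

lemma Cz.cube {s : Eis} (hs : Cz s) (h0 : s ≠ 0) : s ^ 3 = 1 := by
  have e1 := ωE_cube
  rcases hs with rfl | rfl | rfl | rfl
  · exact absurd rfl h0
  · simp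
  · exact e1
  · rw [← pow_mul, mul_comm, pow_mul, e1, one_pow]

lemma Cz.conj_eq {s : Eis} (hs : Cz s) : conjE s = s ^ 2 := by
  have e1 := ωE_cube
  rcases hs with rfl | rfl | rfl | rfl
  · simp
  · simp
  · exact conjE_ω'
  · rw [map_pow, conjE_ω']

lemma Cz.conj {s : Eis} (hs : Cz s) : Cz (conjE s) := by
  rw [hs.conj_eq, pow_two]; exact hs.mul hs

lemma Cz.norm_le {s : Eis} (hs : Cz s) : ‖(s : ℂ)‖ ≤ 1 := by
  have h1 : ‖ωc‖ = 1 := ωc_prim.norm'_eq_one (by norm_num)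
  rcases hs with rfl | rfl | rfl | rfl <;> simp [ωE_coe, h1]

lemma Cz.NmN_sub {s t : Eis} (hs : Cz s) (ht : Cz t) (h : s ≠ t) :
    NmN (s - t) = 1 ∨ NmN (s - t) = 3 := by
  have e0 := ωE_sq
  have key : ∀ (a b : ℤ) (x : Eis), x = (a : Eis) + (b : Eis) * ωE →
      ((NmN x : ℕ) : ℤ) = a ^ 2 - a * b + b ^ 2 := by
    rintro a b x rfl; exact NmN_coords a b
  rcases hs with rfl | rfl | rfl | rfl <;> rcases ht with rfl | rfl | rfl | rfl <;>
    first
    | exact absurd rfl h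
    | skip
  · have := key (-1) 0 (0 - 1) (by push_cast; ring); omega
  · have := key 0 (-1) (0 - ωE) (by push_cast; ring); omega
  · have := key 1 1 (0 - ωE ^ 2) (by push_cast; linear_combination -e0); omega
  · have := key 1 0 (1 - 0) (by push_cast; ring); omega
  · have := key 1 (-1) (1 - ωE) (by push_cast; ring); omega
  · have := key 2 1 (1 - ωE ^ 2) (by push_cast; linear_combination -e0); omega
  · have := key 0 1 (ωE - 0) (by push_cast; ring); omega
  · have := key (-1) 1 (ωE - 1) (by push_cast; ring); omega
  · have := key 1 2 (ωE - ωE ^ 2) (by push_cast; linear_combination -e0); omega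
  · have := key (-1) (-1) (ωE ^ 2 - 0) (by push_cast; linear_combination e0); omega
  · have := key (-2) (-1) (ωE ^ 2 - 1) (by push_cast; linear_combination e0); omega
  · have := key (-1) (-2) (ωE ^ 2 - ωE) (by push_cast; linear_combination e0); omega

lemma Cz.eq_of_dvd {s t p : Eis} (hs : Cz s) (ht : Cz t) (hp : Prime p) (hpp : Pr p)
    (h : p ∣ s - t) : s = t := by
  by_contra hne
  have h1 := NmN_dvd h
  have h2 := hpp.NmN_mod
  have h3 := prime_one_lt_NmN hp
  rcases hs.NmN_sub ht hne with h4 | h4 <;> rw [h4] at h1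
  · have := Nat.le_of_dvd one_pos h1; omega
  · have := Nat.le_of_dvd (by norm_num) h1
    have : NmN p = 2 ∨ NmN p = 3 := by omega
    omega


lemma chi_vals {χ : Eis → Eis → Eis} (hχ : IsCubicSymbol χ)
    {b : Eis} (hb : Pr b) (a : Eis) : Cz (χ b a) := by
  refine pr_induction (P := fun b => Cz (χ b a)) ?_ ?_ b hb
  · rw [hχ.one_bot]; exact Or.inr (Or.inl rfl)
  · intro π b hπ hpπ hb ih
    rw [hχ.mul_bot _ _ _ hpπ hb]
    exact Cz.mul (hχ.prime_vals π a hπ hpπ) ih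

lemma chi_prime_mul {χ : Eis → Eis → Eis} (hχ : IsCubicSymbol χ)
    {π : Eis} (hπ : Prime π) (hpπ : Pr π) (a a' : Eis) :
    χ π (a * a') = χ π a * χ π a' := by
  refine Cz.eq_of_dvd (chi_vals hχ hpπ _) ((chi_vals hχ hpπ _).mul (chi_vals hχ hpπ _)) hπ hpπ ?_
  obtain ⟨x, hx⟩ := hχ.prime_congr π a hπ hpπ
  obtain ⟨y, hy⟩ := hχ.prime_congr π a' hπ hpπ
  obtain ⟨z, hz⟩ := hχ.prime_congr π (a * a') hπ hpπ
  rw [mul_pow] at hz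
  exact ⟨x * a' ^ ((NmN π - 1) / 3) + χ π a * y - z,
    by linear_combination a' ^ ((NmN π - 1) / 3) * hx + χ π a * hy - hz⟩

lemma chi_mul {χ : Eis → Eis → Eis} (hχ : IsCubicSymbol χ)
    {b : Eis} (hb : Pr b) (a a' : Eis) : χ b (a * a') = χ b a * χ b a' := by
  refine pr_induction (P := fun b => χ b (a * a') = χ b a * χ b a') ?_ ?_ b hb
  · simp [hχ.one_bot]
  · intro π b hπ hpπ hb ih
    rw [hχ.mul_bot _ _ _ hpπ hb, hχ.mul_bot _ _ _ hpπ hb, hχ.mul_bot _ _ _ hpπ hb, ih,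
      chi_prime_mul hχ hπ hpπ]
    ring

lemma chi_prime_congr {χ : Eis → Eis → Eis} (hχ : IsCubicSymbol χ)
    {π : Eis} (hπ : Prime π) (hpπ : Pr π) {a a' : Eis} (h : π ∣ a - a') :
    χ π a = χ π a' := by
  refine Cz.eq_of_dvd (chi_vals hχ hpπ _) (chi_vals hχ hpπ _) hπ hpπ ?_
  have h1 := hχ.prime_congr π a hπ hpπ
  have h2 := hχ.prime_congr π a' hπ hpπ
  have h3 := h.trans (sub_dvd_pow_sub_pow a a' ((NmN π - 1) / 3))
  have := dvd_sub (dvd_add h3 h2) h1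
  convert this using 1
  ring

lemma chi_congr' {χ : Eis → Eis → Eis} (hχ : IsCubicSymbol χ)
    {b : Eis} (hb : Pr b) {a a' : Eis}
    (h : ∀ p, Prime p → Pr p → p ∣ b → p ∣ a - a') : χ b a = χ b a' := by
  refine pr_induction (P := fun b => (∀ p, Prime p → Pr p → p ∣ b → p ∣ a - a') →
    χ b a = χ b a') ?_ ?_ b hb h
  · simp [hχ.one_bot]
  · intro π b hπ hpπ hb ih h
    rw [hχ.mul_bot _ _ _ hpπ hb, hχ.mul_bot _ _ _ hpπ hb,
      ih (fun p h1 h2 h3 => h p h1 h2 (h3.mul_left _)),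
      chi_prime_congr hχ hπ hpπ (h π hπ hpπ (dvd_mul_right _ _))]

lemma chi_congr {χ : Eis → Eis → Eis} (hχ : IsCubicSymbol χ)
    {b : Eis} (hb : Pr b) {a a' : Eis} (h : b ∣ a - a') : χ b a = χ b a' :=
  chi_congr' hχ hb (fun _ _ _ h3 => h3.trans h)

lemma chi_ne_zero {χ : Eis → Eis → Eis} (hχ : IsCubicSymbol χ)
    {b a : Eis} (hb : Pr b) : χ b a ≠ 0 ↔ IsCoprime b a := by
  refine pr_induction (P := fun b => χ b a ≠ 0 ↔ IsCoprime b a) ?_ ?_ b hb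
  · simp [hχ.one_bot, isCoprime_one_left]
  · intro π b hπ hpπ hb ih
    rw [hχ.mul_bot _ _ _ hpπ hb, mul_ne_zero_iff, ih, IsCoprime.mul_left_iff]
    refine and_congr_left (fun _ => ?_)
    rw [hπ.irreducible.coprime_iff_not_dvd, Ne, hχ.prime_eq_zero π a hπ hpπ]

lemma chi_one {χ : Eis → Eis → Eis} (hχ : IsCubicSymbol χ)
    {b : Eis} (hb : Pr b) : χ b 1 = 1 := by
  have h1 : χ b 1 ≠ 0 := (chi_ne_zero hχ hb).2 isCoprime_one_right
  have h2 := chi_mul hχ hb 1 1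
  rw [mul_one] at h2
  exact (mul_eq_left₀ h1).1 h2.symm

lemma chi_pow {χ : Eis → Eis → Eis} (hχ : IsCubicSymbol χ)
    {b : Eis} (hb : Pr b) (a : Eis) (n : ℕ) : χ b (a ^ n) = χ b a ^ n := by
  induction n with
  | zero => simp [chi_one hχ hb]
  | succ n ih => rw [pow_succ, chi_mul hχ hb, ih, pow_succ]

lemma chi_neg_one {χ : Eis → Eis → Eis} (hχ : IsCubicSymbol χ)
    {b : Eis} (hb : Pr b) : χ b (-1) = 1 := by
  have h1 : χ b (-1) ≠ 0 := (chi_ne_zero hχ hb).2 isCoprime_one_right.neg_right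
  have h2 := (chi_vals hχ hb (-1)).cube h1
  rw [← chi_pow hχ hb] at h2
  simpa [Odd.neg_one_pow (by decide : Odd 3)] using h2

lemma chi_neg {χ : Eis → Eis → Eis} (hχ : IsCubicSymbol χ)
    {b : Eis} (hb : Pr b) (a : Eis) : χ b (-a) = χ b a := by
  rw [neg_eq_neg_one_mul, chi_mul hχ hb, chi_neg_one hχ hb, one_mul]


/-- conjugation as an equivalence -/
def conjEquiv : Eis ≃+* Eis := RingEquiv.ofRingHom conjE conjE
  (RingHom.ext conjE_conjE) (RingHom.ext conjE_conjE)

lemma prime_conj {p : Eis} (hp : Prime p) : Prime (conjE p) :=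
  (MulEquiv.prime_iff conjEquiv).2 hp

lemma chi_conj {χ : Eis → Eis → Eis} (hχ : IsCubicSymbol χ) {b : Eis} (hb : Pr b) (a : Eis) :
    χ (conjE b) (conjE a) = conjE (χ b a) := by
  refine pr_induction (P := fun b => χ (conjE b) (conjE a) = conjE (χ b a)) ?_ ?_ b hb
  · simp [hχ.one_bot]
  · intro π b hπ hpπ hb ih
    rw [hχ.mul_bot _ _ _ hpπ hb, map_mul, map_mul, hχ.mul_bot _ _ _ hpπ.conj hb.conj, ih]
    congr 1
    refine Cz.eq_of_dvd (chi_vals hχ hpπ.conj _) (chi_vals hχ hpπ _).conj (prime_conj hπ)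
      hpπ.conj ?_
    have h1 := hχ.prime_congr _ (conjE a) (prime_conj hπ) hpπ.conj
    have h2 := map_dvd conjE (hχ.prime_congr π a hπ hpπ)
    rw [map_sub, map_pow] at h2
    rw [NmN_conjE] at h1
    have := dvd_sub h2 h1
    convert this using 1
    ring

/-! ### Cubic reciprocity -/

lemma ωE_prim : IsPrimitiveRoot ωE 3 :=
  IsPrimitiveRoot.of_map_of_injective (f := Eis.subtype) (by exact ωc_prim)
    Subtype.coe_injective

/-- The cubic character on a residue field. -/
def chiF {χ : Eis → Eis → Eis} (hχ : IsCubicSymbol χ) {π : Eis} (hπ : Prime π) (hpπ : Pr π)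
    {F : Type} [Field F] (φ : Eis →+* F) (hs : Function.Surjective φ)
    (hk : ∀ x, φ x = 0 ↔ π ∣ x) : MulChar F Eis where
  toFun y := χ π (Function.surjInv hs y)
  map_one' := by
    rw [← chi_one hχ hpπ]
    apply chi_congr hχ hpπ
    rw [← hk, map_sub, Function.surjInv_eq hs, map_one, sub_self]
  map_mul' x y := by
    rw [← chi_mul hχ hpπ]
    apply chi_congr hχ hpπ
    rw [← hk, map_sub, map_mul, Function.surjInv_eq hs, Function.surjInv_eq hs, Function.surjInv_eq hs,
      sub_self]
  map_nonunit' a ha := by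
    rw [isUnit_iff_ne_zero, not_not] at ha
    have h1 := hχ.prime_eq_zero π (Function.surjInv hs a) hπ hpπ
    refine h1.2 ?_
    rw [← hk, Function.surjInv_eq hs, ha]

section recip
variable {χ : Eis → Eis → Eis} (hχ : IsCubicSymbol χ) {π : Eis} (hπ : Prime π) (hpπ : Pr π)
    {F : Type} [Field F] (φ : Eis →+* F) (hs : Function.Surjective φ)
    (hk : ∀ x, φ x = 0 ↔ π ∣ x)

lemma chiF_apply (x : Eis) : chiF hχ hπ hpπ φ hs hk (φ x) = χ π x := by
  change χ π (Function.surjInv hs (φ x)) = χ π x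
  apply chi_congr hχ hpπ
  rw [← hk, map_sub, Function.surjInv_eq hs, sub_self]

lemma chiF_Cz (y : F) : Cz (chiF hχ hπ hpπ φ hs hk y) := chi_vals hχ hpπ _

lemma φ_chiF (y : F) : φ (chiF hχ hπ hpπ φ hs hk y) = y ^ ((NmN π - 1) / 3) := by
  obtain ⟨x, rfl⟩ := hs y
  rw [chiF_apply]
  have := (hk _).2 (hχ.prime_congr π x hπ hpπ)
  rw [map_sub, map_pow, sub_eq_zero] at this
  exact this.symm

lemma chiF_cube : (chiF hχ hπ hpπ φ hs hk) ^ 3 = 1 := by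
  refine MulChar.ext fun u => ?_
  rw [MulChar.pow_apply_coe, MulChar.one_apply_coe]
  exact (chiF_Cz hχ hπ hpπ φ hs hk u).cube (MulChar.apply_ne_zero_iff.2 u.isUnit)

lemma chiF_exists [Fintype F] (hc : Fintype.card F = NmN π) :
    ∃ y : F, y ≠ 0 ∧ chiF hχ hπ hpπ φ hs hk y ≠ 1 := by
  classical
  by_contra hcon
  push Not at hcon
  obtain ⟨g, hg⟩ := IsCyclic.exists_generator (α := Fˣ)
  have h1 := orderOf_eq_card_of_forall_mem_zpowers hg
  rw [Nat.card_eq_fintype_card, Fintype.card_units, hc] at h1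
  have h2 := hcon (g : F) g.ne_zero
  have h3 := φ_chiF hχ hπ hpπ φ hs hk (g : F)
  rw [h2, map_one] at h3
  have h4 : g ^ ((NmN π - 1) / 3) = 1 := by
    apply Units.ext; push_cast; exact h3.symm
  have h5 := orderOf_dvd_of_pow_eq_one h4
  rw [h1] at h5
  have h6 := prime_one_lt_NmN hπ
  have h7 := hpπ.NmN_mod
  have h8 := Nat.le_of_dvd (by omega) h5
  omega

lemma chiF_ne_one [Fintype F] (hc : Fintype.card F = NmN π) : chiF hχ hπ hpπ φ hs hk ≠ 1 := by
  obtain ⟨y, hy, h⟩ := chiF_exists hχ hπ hpπ φ hs hk hc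
  intro h1
  rw [h1, MulChar.one_apply (isUnit_iff_ne_zero.2 hy)] at h
  exact h rfl

lemma sum_pow_mul_eq_zero [Fintype F] (m : ℕ) (hm : 2 * m < Fintype.card F - 1) :
    ∑ y : F, y ^ m * (1 - y) ^ m = 0 := by
  have : ∀ y : F, y ^ m * (1 - y) ^ m
      = ∑ i ∈ Finset.range (m + 1), ((-1) ^ i * (m.choose i : F)) * y ^ (m + i) := by
    intro y
    rw [sub_eq_neg_add, add_pow, Finset.mul_sum]
    refine Finset.sum_congr rfl (fun i _ => ?_)
    rw [neg_pow y i, one_pow, pow_add]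
    ring
  simp_rw [this]
  rw [Finset.sum_comm]
  refine Finset.sum_eq_zero (fun i hi => ?_)
  rw [← Finset.mul_sum, FiniteField.sum_pow_lt_card_sub_one, mul_zero]
  rw [Finset.mem_range] at hi
  omega

lemma jacobi_eq [Fintype F] (hc : Fintype.card F = NmN π) :
    jacobiSum (chiF hχ hπ hpπ φ hs hk) (chiF hχ hπ hpπ φ hs hk) = -π := by
  set X := chiF hχ hπ hpπ φ hs hk with hX
  have hX1 : X ≠ 1 := chiF_ne_one hχ hπ hpπ φ hs hk hc
  have hX3 : X ^ 3 = 1 := chiF_cube hχ hπ hpπ φ hs hk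
  have hX2 : X * X ≠ 1 := by
    intro h
    apply hX1
    rw [pow_succ, pow_two, h, one_mul] at hX3
    exact hX3
  have hinv : X⁻¹ = X * X := by
    rw [inv_eq_iff_mul_eq_one, ← hX3, pow_succ, pow_two, mul_assoc]
  have h6 := prime_one_lt_NmN hπ
  have h7 := hpπ.NmN_mod
  -- divisibility
  have hdvd : π ∣ jacobiSum X X := by
    rw [← hk, jacobiSum, map_sum]
    simp_rw [map_mul, hX, φ_chiF]
    apply sum_pow_mul_eq_zero
    rw [hc]; omega
  -- norm
  have hinj : Function.Injective Eis.subtype := Subtype.coe_injective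
  have hconj : X⁻¹ = X.ringHomComp conjE := by
    rw [hinv]
    ext u
    rw [MulChar.mul_apply, MulChar.ringHomComp_apply, (chiF_Cz hχ hπ hpπ φ hs hk u).conj_eq, pow_two]
  have hnorm : NmN (jacobiSum X X) = NmN π := by
    have hinjm := MulChar.injective_ringHomComp (R := F) hinj
    have h1 : X.ringHomComp Eis.subtype ≠ 1 := by
      rwa [MulChar.ringHomComp_ne_one_iff hinj]
    have h2 : X.ringHomComp Eis.subtype * X.ringHomComp Eis.subtype ≠ 1 := by
      rwa [← MulChar.ringHomComp_mul, MulChar.ringHomComp_ne_one_iff hinj]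
    have h3 := jacobiSum_mul_jacobiSum_inv (F := F) (F' := ℂ) (by
      rw [ringChar.eq_zero]
      exact (CharP.ringChar_ne_zero_of_finite F).symm) h1 h1 h2
    rw [MulChar.ringHomComp_inv, jacobiSum_ringHomComp, jacobiSum_ringHomComp, hconj,
      jacobiSum_ringHomComp, ← map_mul, mul_conjE, hc, map_natCast] at h3
    exact_mod_cast h3
  obtain ⟨u, hu⟩ := hdvd
  have hu1 : IsUnit u := by
    rw [isUnit_iff_NmN]
    rw [hu, NmN_mul] at hnorm
    exact Nat.eq_of_mul_eq_mul_left (NmN_pos hπ.ne_zero) (by rw [hnorm, mul_one])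
  obtain ⟨z, -, hz⟩ := exists_jacobiSum_eq_neg_one_add (by norm_num) hX3 hX3
    (by rw [hc]; omega) ωE_prim
  have h9 : Pr (-u * π) := by
    refine ⟨z * ωE, ?_⟩
    linear_combination hu - hz - z * ωE_sq
  have := Pr.unit_eq_one hu1.neg hpπ h9
  rw [hu]
  linear_combination -π * this

lemma gaussSum_frob_iterate {R R' : Type*} [CommRing R] [Fintype R] [CommRing R'] (p : ℕ)
    [Fact p.Prime] [CharP R' p] (X : MulChar R R') (ψ : AddChar R R') (n : ℕ) :
    gaussSum X ψ ^ p ^ n = gaussSum (X ^ p ^ n) (ψ ^ p ^ n) := by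
  induction n with
  | zero => simp
  | succ n ih => rw [pow_succ, pow_mul, ih, gaussSum_frob, ← pow_mul, ← pow_mul]

end recip

lemma recip_aux {χ : Eis → Eis → Eis} (hχ : IsCubicSymbol χ) {π : Eis} (hπ : Prime π) (hpπ : Pr π)
    {F : Type} [Field F] (φ : Eis →+* F) (hs : Function.Surjective φ)
    (hk : ∀ x, φ x = 0 ↔ π ∣ x) [Fintype F] (hc : Fintype.card F = NmN π) {ρ : Eis} (hρ : Prime ρ) (hpρ : Pr ρ)
    {K : Type} [Field K] [Fintype K] (φ' : Eis →+* K)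
    (hk' : ∀ x, φ' x = 0 ↔ ρ ∣ x) (hc' : Fintype.card K = NmN ρ)
    (hcop : Nat.Coprime (NmN π) (NmN ρ)) :
    χ π ((NmN ρ : ℕ) : Eis) * χ ρ (((NmN π : ℕ) : Eis) * π) = 1 := by
  set X := chiF hχ hπ hpπ φ hs hk with hX
  have hX3 : X ^ 3 = 1 := chiF_cube hχ hπ hpπ φ hs hk
  have h6 := prime_one_lt_NmN hρ
  have h7 := hpρ.NmN_mod
  obtain ⟨n, hp, hn⟩ := FiniteField.card F (ringChar F)
  obtain ⟨n', hp', hn'⟩ := FiniteField.card K (ringChar K)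
  have hne : ringChar K ≠ ringChar F := by
    intro h
    rw [← hc, ← hc', hn, hn', h] at hcop
    have := (Nat.coprime_pow_left_iff n.pos _ _).1 hcop
    have := (Nat.coprime_pow_right_iff n'.pos _ _).1 this
    rw [Nat.coprime_self] at this
    exact hp.one_lt.ne' this
  have hqK : ((NmN π : ℕ) : K) ≠ 0 := by
    rw [Ne, ringChar.spec, ← hc, hn]
    intro h
    exact hne ((Nat.prime_dvd_prime_iff_eq hp' hp).1 (hp'.dvd_of_dvd_pow h))
  have hQF : ((NmN ρ : ℕ) : F) ≠ 0 := by
    rw [Ne, ringChar.spec, ← hc', hn']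
    intro h
    exact hne ((Nat.prime_dvd_prime_iff_eq hp hp').1 (hp.dvd_of_dvd_pow h)).symm
  let P := AddChar.FiniteField.primitiveChar F K hne
  let R' := CyclotomicField P.n K
  let f : Eis →+* R' := (algebraMap K R').comp φ'
  have hf : ∀ x, f x = 0 ↔ ρ ∣ x := by
    intro x
    rw [← hk', ← map_eq_zero (algebraMap K R')]; rfl
  let Y : MulChar F R' := X.ringHomComp f
  have hY3 : Y ^ 3 = 1 := by
    rw [MulChar.ringHomComp_pow, hX3, MulChar.ringHomComp_one]
  have hY1 : Y ≠ 1 := by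
    obtain ⟨y, hy, h⟩ := chiF_exists hχ hπ hpπ φ hs hk hc
    intro h1
    apply h
    have h2 : f (X y) = 1 := by
      rw [← MulChar.ringHomComp_apply, show X.ringHomComp f = 1 from h1,
        MulChar.one_apply (isUnit_iff_ne_zero.2 hy)]
    refine Cz.eq_of_dvd (chiF_Cz hχ hπ hpπ φ hs hk y) (Or.inr (Or.inl rfl)) hρ hpρ ?_
    rw [← hf, map_sub, map_one, ← hX, h2, sub_self]
  have hord : orderOf Y = 3 := orderOf_eq_prime hY3 hY1
  let g : R' := gaussSum Y P.char
  have hg3 : g ^ 3 = f (-(((NmN π : ℕ) : Eis) * π)) := by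
    have := gaussSum_pow_eq_prod_jacobiSum (χ := Y) (ψ := P.char) (by rw [hord]; norm_num) P.prim
    rw [hord] at this
    simp only [Nat.reduceSub, Nat.Ico_succ_singleton, Finset.prod_singleton, pow_one] at this
    change gaussSum Y P.char ^ 3 = _
    rw [this, jacobiSum_ringHomComp, jacobi_eq hχ hπ hpπ φ hs hk hc, MulChar.ringHomComp_apply,
      ← map_one φ, ← map_neg, chiF_apply, chi_neg_one hχ hpπ, hc, map_one, one_mul,
      ← map_natCast f, ← map_mul]
    congr 1; ring
  have hfq : f ((NmN π : ℕ) : Eis) ≠ 0 := by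
    change algebraMap K R' (φ' _) ≠ 0
    rwa [map_natCast, Ne, map_eq_zero]
  have hfπ : f π ≠ 0 := by
    rw [← mul_conjE, map_mul] at hfq
    exact left_ne_zero_of_mul hfq
  have hg0 : g ≠ 0 := by
    intro h
    rw [h, map_neg, map_mul] at hg3
    have : f ((NmN π : ℕ) : Eis) * f π = 0 := by
      linear_combination hg3
    exact mul_ne_zero hfq hfπ this
  haveI : Fact (ringChar K).Prime := ⟨hp'⟩
  haveI : CharP R' (ringChar K) := charP_of_injective_algebraMap (algebraMap K R').injective _
  have hfrob := gaussSum_frob_iterate (ringChar K) Y P.char n'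
  rw [← hn', hc'] at hfrob
  have hQ : NmN ρ = 3 * ((NmN ρ - 1) / 3) + 1 := by omega
  have hYQ : Y ^ NmN ρ = Y := by
    rw [hQ, pow_succ, pow_mul, hY3, one_pow, one_mul]
  rw [hYQ, AddChar.pow_mulShift] at hfrob
  have hsh := gaussSum_mulShift Y P.char (Units.mk0 _ hQF)
  rw [Units.val_mk0, ← hfrob] at hsh
  have hsh2 : Y ((NmN ρ : ℕ) : F) * (g ^ 3) ^ ((NmN ρ - 1) / 3) = 1 := by
    have : Y ((NmN ρ : ℕ) : F) * g ^ NmN ρ = g := hsh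
    rw [hQ, pow_succ, pow_mul, ← hQ, ← mul_assoc] at this
    exact (mul_eq_right₀ hg0).1 this
  rw [hg3, ← map_pow, MulChar.ringHomComp_apply, ← map_natCast φ, chiF_apply] at hsh2
  have h8 := (hf _).2 (hχ.prime_congr ρ (-(((NmN π : ℕ) : Eis) * π)) hρ hpρ)
  rw [map_sub, sub_eq_zero] at h8
  rw [h8, chi_neg hχ hpρ, ← map_mul] at hsh2
  refine Cz.eq_of_dvd ((chi_vals hχ hpπ _).mul (chi_vals hχ hpρ _)) (Or.inr (Or.inl rfl)) hρ hpρ ?_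
  rw [← hf, map_sub, map_one, hsh2, sub_self]

lemma quot_mk_eq_zero {π x : Eis} :
    Ideal.Quotient.mk (Ideal.span {π}) x = 0 ↔ π ∣ x := by
  rw [Ideal.Quotient.eq_zero_iff_mem, Ideal.mem_span_singleton]

lemma recip_aux' {χ : Eis → Eis → Eis} (hχ : IsCubicSymbol χ) {π ρ : Eis}
    (hπ : Prime π) (hpπ : Pr π) (hρ : Prime ρ) (hpρ : Pr ρ)
    (hcop : Nat.Coprime (NmN π) (NmN ρ)) :
    χ π ((NmN ρ : ℕ) : Eis) * χ ρ (((NmN π : ℕ) : Eis) * π) = 1 := by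
  haveI m1 : (Ideal.span {π}).IsMaximal :=
    PrincipalIdealRing.isMaximal_of_irreducible hπ.irreducible
  haveI m2 : (Ideal.span {ρ}).IsMaximal :=
    PrincipalIdealRing.isMaximal_of_irreducible hρ.irreducible
  letI f1 : Field (Eis ⧸ Ideal.span {π}) := Ideal.Quotient.field _
  letI f2 : Field (Eis ⧸ Ideal.span {ρ}) := Ideal.Quotient.field _
  haveI := finite_quot hπ.ne_zero
  haveI := finite_quot hρ.ne_zero
  letI t1 : Fintype (Eis ⧸ Ideal.span {π}) := Fintype.ofFinite _
  letI t2 : Fintype (Eis ⧸ Ideal.span {ρ}) := Fintype.ofFinite _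
  refine recip_aux hχ hπ hpπ (Ideal.Quotient.mk (Ideal.span {π})) Ideal.Quotient.mk_surjective
    (fun x => quot_mk_eq_zero) ?_ hρ hpρ (Ideal.Quotient.mk (Ideal.span {ρ}))
    (fun x => quot_mk_eq_zero) ?_ hcop
  · rw [← Nat.card_eq_fintype_card, card_quot]
  · rw [← Nat.card_eq_fintype_card, card_quot]

lemma recip_prime_coprime {χ : Eis → Eis → Eis} (hχ : IsCubicSymbol χ) {π ρ : Eis}
    (hπ : Prime π) (hpπ : Pr π) (hρ : Prime ρ) (hpρ : Pr ρ)
    (hcop : Nat.Coprime (NmN π) (NmN ρ)) : χ π ρ = χ ρ π := by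
  have h1 := recip_aux' hχ hπ hpπ hρ hpρ hcop
  have h2 := recip_aux' hχ hρ hpρ hπ hpπ hcop.symm
  rw [← mul_conjE, ← mul_conjE, chi_mul hχ hpπ, chi_mul hχ hpρ, chi_mul hχ hpρ] at h1
  rw [← mul_conjE, ← mul_conjE, chi_mul hχ hpπ, chi_mul hχ hpρ, chi_mul hχ hpπ] at h2
  linear_combination (-χ π ρ) * h1 + χ ρ π * h2

lemma recip_coprime {χ : Eis → Eis → Eis} (hχ : IsCubicSymbol χ) {a b : Eis}
    (ha : Pr a) (hb : Pr b) (hcop : Nat.Coprime (NmN a) (NmN b)) : χ a b = χ b a := by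
  refine pr_induction (P := fun a => Nat.Coprime (NmN a) (NmN b) → χ a b = χ b a)
    ?_ ?_ a ha hcop
  · intro _
    rw [hχ.one_bot, chi_one hχ hb]
  · intro π a hπ hpπ ha ih h
    rw [NmN_mul, Nat.coprime_mul_iff_left] at h
    rw [hχ.mul_bot _ _ _ hpπ ha, chi_mul hχ hb, ih h.2]
    congr 1
    have h' := h.1
    refine pr_induction (P := fun b => Nat.Coprime (NmN π) (NmN b) → χ π b = χ b π)
      ?_ ?_ b hb h'
    · intro _
      rw [hχ.one_bot, chi_one hχ hpπ]
    · intro ρ b hρ hpρ hb ih2 h2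
      rw [NmN_mul, Nat.coprime_mul_iff_right] at h2
      rw [hχ.mul_bot _ _ _ hpρ hb, chi_mul hχ hpπ, ih2 h2.2,
        recip_prime_coprime hχ hπ hpπ hρ hpρ h2.1]

lemma coprime_of_isCoprime {a b : ℕ} (h : IsCoprime (a : Eis) (b : Eis)) : Nat.Coprime a b := by
  rw [Nat.coprime_iff_isRelPrime]
  intro l ha hb
  have h1 : IsUnit (l : Eis) :=
    h.isRelPrime (Nat.cast_dvd_cast ha) (Nat.cast_dvd_cast hb)
  rw [isUnit_iff_NmN] at h1
  have h2 := NmN_coords l 0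
  rw [show (((l : ℤ) : Eis) + ((0 : ℤ) : Eis) * ωE) = (l : Eis) by simp, h1] at h2
  have h3 : (l : ℤ) * l = 1 := by push_cast at h2; linarith
  have h4 : l * l = 1 := by exact_mod_cast h3
  rw [Nat.isUnit_iff]
  exact Nat.eq_one_of_mul_eq_one_right h4

lemma prime_coprime_or_eq {π ρ : Eis} (hπ : Prime π) (hpπ : Pr π) (hρ : Prime ρ) (hpρ : Pr ρ) :
    IsCoprime π ρ ∨ π = ρ := by
  by_cases h : π ∣ ρ
  · exact Or.inr (hpπ.eq_of_associated hpρ (hπ.associated_of_dvd hρ h))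
  · exact Or.inl (hπ.irreducible.coprime_iff_not_dvd.2 h)

lemma recip_conj {χ : Eis → Eis → Eis} (hχ : IsCubicSymbol χ) {π : Eis}
    (hπ : Prime π) (hpπ : Pr π) : χ π (conjE π) = χ (conjE π) π := by
  rcases prime_coprime_or_eq hπ hpπ (prime_conj hπ) hpπ.conj with h | h
  swap
  · rw [← h]
  set s := π + conjE π with hs
  have hps : Pr (-s) := by
    obtain ⟨y, hy⟩ := hpπ.conj
    obtain ⟨x, hx⟩ := id hpπ
    exact ⟨-x - y - 1, by rw [hs]; linear_combination -hx - hy⟩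
  have hsc : conjE (-s) = -s := by
    rw [hs, map_neg, map_add, conjE_conjE]; ring
  have hc1 : IsCoprime π s := by
    have := IsCoprime.add_mul_left_right h 1
    rw [mul_one] at this
    rw [hs, add_comm]; exact this
  have hc2 : IsCoprime (conjE π) s := by
    have := IsCoprime.add_mul_left_right h.symm 1
    rw [mul_one] at this
    rw [hs]; exact this
  have hcop : Nat.Coprime (NmN π) (NmN (-s)) := by
    apply coprime_of_isCoprime
    rw [← mul_conjE, ← mul_conjE, hsc]
    have := (hc1.mul_left hc2).neg_right
    exact this.mul_right this
  have h1 := recip_coprime hχ hpπ hps hcop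
  have h2 : χ π (-s) = χ π (conjE π) := by
    rw [chi_neg hχ hpπ]
    apply chi_congr hχ hpπ
    exact ⟨1, by rw [hs]; ring⟩
  have h3 : χ (-s) π = χ (-s) (conjE π) := by
    rw [← chi_neg hχ hps (conjE π)]
    apply chi_congr hχ hps
    exact ⟨-1, by rw [hs]; ring⟩
  have h4 : χ (-s) (conjE π) = conjE (χ (-s) π) := by
    have := chi_conj hχ hps π
    rwa [hsc] at this
  have h5 : χ (conjE π) π = conjE (χ π (conjE π)) := by
    have := chi_conj hχ hpπ (conjE π)
    rwa [conjE_conjE] at this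
  rw [h5, ← h2, h1, ← h4, ← h3]

lemma recip_prime {χ : Eis → Eis → Eis} (hχ : IsCubicSymbol χ) {π ρ : Eis}
    (hπ : Prime π) (hpπ : Pr π) (hρ : Prime ρ) (hpρ : Pr ρ) : χ π ρ = χ ρ π := by
  rcases prime_coprime_or_eq hπ hpπ hρ hpρ with h | rfl
  swap
  · rfl
  rcases prime_coprime_or_eq hπ hpπ (prime_conj hρ) hpρ.conj with h2 | h2
  swap
  · have := recip_conj hχ hρ hpρ
    rw [← h2] at this
    exact this.symm
  apply recip_prime_coprime hχ hπ hpπ hρ hpρ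
  apply coprime_of_isCoprime
  rw [← mul_conjE, ← mul_conjE]
  have h3 : IsCoprime (conjE π) (conjE ρ) := h.map conjE
  have h4 : IsCoprime (conjE π) ρ := by
    have := h2.map conjE
    rwa [conjE_conjE] at this
  exact (h.mul_right h2).mul_left (h4.mul_right h3)

/-- Cubic reciprocity. -/
theorem recip {χ : Eis → Eis → Eis} (hχ : IsCubicSymbol χ) {a b : Eis}
    (ha : Pr a) (hb : Pr b) : χ a b = χ b a := by
  refine pr_induction (P := fun a => χ a b = χ b a) ?_ ?_ a ha
  · rw [hχ.one_bot, chi_one hχ hb]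
  · intro π a hπ hpπ ha ih
    rw [hχ.mul_bot _ _ _ hpπ ha, chi_mul hχ hb, ih]
    congr 1
    refine pr_induction (P := fun b => χ π b = χ b π) ?_ ?_ b hb
    · rw [hχ.one_bot, chi_one hχ hpπ]
    · intro ρ b hρ hpρ hb ih2
      rw [hχ.mul_bot _ _ _ hpρ hb, chi_mul hχ hpπ, ih2, recip_prime hχ hπ hpπ hρ hpρ]

/-! ### Gauss sums -/

lemma eE_add (z w : ℂ) : eE (z + w) = eE z * eE w := by
  rw [eE, eE, eE, ← Complex.exp_add, map_add]
  congr 1; ring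

lemma eE_norm (z : ℂ) : ‖eE z‖ = 1 := by
  have : z + (starRingEnd ℂ) z = ((2 * z.re : ℝ) : ℂ) := by
    rw [Complex.add_conj]
  rw [eE, this, show 2 * (Real.pi : ℂ) * I * ((2 * z.re : ℝ) : ℂ)
    = ((2 * Real.pi * (2 * z.re) : ℝ) : ℂ) * I by push_cast; ring, Complex.norm_exp_ofReal_mul_I]

lemma eE_eq_one {z : ℂ} : eE z = 1 ↔ ∃ n : ℤ, z + (starRingEnd ℂ) z = n := by
  rw [eE, Complex.exp_eq_one_iff]
  refine exists_congr fun n => ?_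
  have h : (2 * (Real.pi : ℂ) * I) ≠ 0 := Complex.two_pi_I_ne_zero
  constructor
  · intro h1
    apply mul_left_cancel₀ h
    rw [h1]; ring
  · intro h1
    rw [h1]; ring

lemma eE_coe (x : Eis) : eE (x : ℂ) = 1 := by
  rw [eE_eq_one]
  obtain ⟨a, b, rfl⟩ := coords x
  refine ⟨2 * a - b, ?_⟩
  push_cast
  rw [map_add, map_mul, ωE_coe, ωc_conj, map_intCast, map_intCast]
  ring

lemma eE_dual {z : ℂ} (h1 : eE z = 1) (h2 : eE (z * ωc) = 1) :
    ∃ y : Eis, (y : ℂ) = (lam : ℂ) * z := by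
  rw [eE_eq_one] at h1 h2
  obtain ⟨p, hp⟩ := h1
  obtain ⟨q, hq⟩ := h2
  refine ⟨((p + q : ℤ) : Eis) + ((p : ℤ) : Eis) * ωE, ?_⟩
  rw [map_mul, ωc_conj] at hq
  have hl : (lam : ℂ) = 1 + 2 * ωc := by
    rw [lam]; push_cast; rfl
  rw [hl]
  push_cast
  rw [ωE_coe, ← hp, ← hq]
  ring

lemma Pr.coprime_lam {c : Eis} (hc : Pr c) : IsCoprime c lam := by
  obtain ⟨x, hx⟩ := hc
  exact ⟨1, lam * x, by linear_combination hx + x * lam_sq⟩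

/-- The summand of the Gauss sum. -/
def Fg (χ : Eis → Eis → Eis) (m c x : Eis) : ℂ :=
  ((χ c x : Eis) : ℂ) * eE (((m * x : Eis) : ℂ) / (c : ℂ))

lemma coe_ne_zero {c : Eis} (hc : c ≠ 0) : (c : ℂ) ≠ 0 := by
  intro h; exact hc (Subtype.ext h)

lemma Fg_congr {χ : Eis → Eis → Eis} (hχ : IsCubicSymbol χ) {c : Eis} (hc : Pr c) (m : Eis)
    {x y : Eis} (h : c ∣ x - y) : Fg χ m c x = Fg χ m c y := by
  rw [Fg, Fg, chi_congr hχ hc h]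
  congr 1
  obtain ⟨z, hz⟩ := h
  have hc0 := coe_ne_zero hc.ne_zero
  have hx : x = y + c * z := by linear_combination hz
  have : (((m * x : Eis) : ℂ) / (c : ℂ)) = (((m * y : Eis) : ℂ) / (c : ℂ)) + ((m * z : Eis) : ℂ) := by
    rw [hx]; push_cast; field_simp
  rw [this, eE_add, eE_coe, mul_one]

lemma out_dvd {c : Eis} (x : Eis) :
    c ∣ (Ideal.Quotient.mk (Ideal.span {c}) x).out - x := by
  rw [← quot_mk_eq_zero, map_sub, sub_eq_zero]
  exact Ideal.Quotient.mk_out _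

lemma mk_eq_iff {c x y : Eis} :
    Ideal.Quotient.mk (Ideal.span {c}) x = Ideal.Quotient.mk (Ideal.span {c}) y ↔ c ∣ x - y := by
  rw [← quot_mk_eq_zero, map_sub, sub_eq_zero]

lemma g₃_eq_sum (χ : Eis → Eis → Eis) (m c : Eis) [Fintype (Eis ⧸ Ideal.span {c})] :
    g₃ χ m c = ∑ d : Eis ⧸ Ideal.span {c}, Fg χ m c d.out := by
  rw [g₃, finsum_eq_sum_of_fintype]; rfl

/-- Reindexing the Gauss sum by any bijection. -/
lemma g₃_reindex {χ : Eis → Eis → Eis} (hχ : IsCubicSymbol χ) {c : Eis} (hc : Pr c) (m : Eis)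
    {ι : Type} [Fintype ι] (f : ι → Eis)
    (hf : Function.Bijective fun i => Ideal.Quotient.mk (Ideal.span {c}) (f i)) :
    g₃ χ m c = ∑ i, Fg χ m c (f i) := by
  have := finite_quot hc.ne_zero
  let _ : Fintype (Eis ⧸ Ideal.span {c}) := Fintype.ofFinite _
  rw [g₃_eq_sum]
  symm
  refine Fintype.sum_bijective _ hf _ _ fun i => ?_
  exact (Fg_congr hχ hc m (out_dvd _)).symm

lemma g₃_norm_le {χ : Eis → Eis → Eis} (hχ : IsCubicSymbol χ) {c : Eis} (hc : Pr c) (m : Eis) :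
    ‖g₃ χ m c‖ ≤ Nm c := by
  have := finite_quot hc.ne_zero
  let _ : Fintype (Eis ⧸ Ideal.span {c}) := Fintype.ofFinite _
  rw [g₃_eq_sum]
  refine (norm_sum_le _ _).trans ?_
  have h : ∀ d ∈ (Finset.univ : Finset (Eis ⧸ Ideal.span {c})), ‖Fg χ m c d.out‖ ≤ 1 := by
    intro d _
    rw [Fg, norm_mul, eE_norm, mul_one]
    exact (chi_vals hχ hc _).norm_le
  refine (Finset.sum_le_sum h).trans ?_
  rw [Finset.sum_const, Finset.card_univ, ← Nat.card_eq_fintype_card, card_quot, nsmul_eq_mul,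
    mul_one, NmN_cast]

/-- Shift lemma. -/
lemma g₃_shift {χ : Eis → Eis → Eis} (hχ : IsCubicSymbol χ) {c : Eis} (hc : Pr c) {m e : Eis}
    (he : ∀ p, Prime p → p ∣ c → p ∣ e) (h0 : g₃ χ m c ≠ 0) : c ∣ m * e := by
  have hfin := finite_quot hc.ne_zero
  let _ : Fintype (Eis ⧸ Ideal.span {c}) := Fintype.ofFinite _
  have hc0 := coe_ne_zero hc.ne_zero
  have key : ∀ x : Eis, eE (((m * e : Eis) : ℂ) / c * x) = 1 := by
    intro x
    have h1 : g₃ χ m c = ∑ d : Eis ⧸ Ideal.span {c}, Fg χ m c (d.out + e * x) := by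
      refine g₃_reindex hχ hc m (fun d : Eis ⧸ Ideal.span {c} => d.out + e * x) ?_
      have : (fun d : Eis ⧸ Ideal.span {c} =>
          Ideal.Quotient.mk (Ideal.span {c}) (d.out + e * x))
          = fun d => d + Ideal.Quotient.mk (Ideal.span {c}) (e * x) := by
        funext d
        rw [map_add, Ideal.Quotient.mk_out]
      rw [this]
      exact (Equiv.addRight _).bijective
    have h2 : ∀ d : Eis ⧸ Ideal.span {c}, Fg χ m c (d.out + e * x)
        = Fg χ m c d.out * eE (((m * e : Eis) : ℂ) / c * x) := by
      intro d
      have h3 : χ c (d.out + e * x) = χ c d.out := by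
        apply chi_congr' hχ hc
        intro p hp _ hpc
        rw [add_sub_cancel_left]
        exact (he p hp hpc).mul_right x
      rw [Fg, Fg, h3, mul_assoc, ← eE_add]
      congr 2
      push_cast; ring
    simp_rw [h2] at h1
    rw [← Finset.sum_mul, ← g₃_eq_sum] at h1
    exact (mul_eq_left₀ h0).1 h1.symm
  obtain ⟨y, hy⟩ := eE_dual (by simpa using key 1) (by simpa [ωE_coe] using key ωE)
  have h5 : lam * (m * e) = c * y := by
    apply Subtype.ext
    push_cast
    rw [hy]
    push_cast
    field_simp
  exact hc.coprime_lam.dvd_of_dvd_mul_left ⟨y, h5⟩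

/-- Multiplicativity. -/
lemma g₃_mul {χ : Eis → Eis → Eis} (hχ : IsCubicSymbol χ) {w n : Eis} (hw : Pr w) (hn : Pr n)
    (hcop : IsCoprime w n) (m : Eis) :
    g₃ χ m (w * n) = ((χ w n : Eis) : ℂ) * ((χ n w : Eis) : ℂ) * g₃ χ m w * g₃ χ m n := by
  have f1 := finite_quot hw.ne_zero
  have f2 := finite_quot hn.ne_zero
  have f3 := finite_quot (hw.mul hn).ne_zero
  let _ : Fintype (Eis ⧸ Ideal.span {w}) := Fintype.ofFinite _
  let _ : Fintype (Eis ⧸ Ideal.span {n}) := Fintype.ofFinite _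
  let _ : Fintype (Eis ⧸ Ideal.span {w * n}) := Fintype.ofFinite _
  have hw0 := coe_ne_zero hw.ne_zero
  have hn0 := coe_ne_zero hn.ne_zero
  rw [g₃_reindex hχ (hw.mul hn) m
    (fun p : (Eis ⧸ Ideal.span {w}) × (Eis ⧸ Ideal.span {n}) => p.1.out * n + p.2.out * w) ?_]
  · rw [g₃_eq_sum, g₃_eq_sum, mul_assoc, Finset.sum_mul_sum, Fintype.sum_prod_type,
      Finset.mul_sum]
    refine Finset.sum_congr rfl fun a _ => ?_
    rw [Finset.mul_sum]
    refine Finset.sum_congr rfl fun b _ => ?_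
    simp only
    have h1 : χ w (a.out * n + b.out * w) = χ w a.out * χ w n := by
      rw [← chi_mul hχ hw]
      exact chi_congr hχ hw ⟨b.out, by ring⟩
    have h2 : χ n (a.out * n + b.out * w) = χ n b.out * χ n w := by
      rw [← chi_mul hχ hn]
      exact chi_congr hχ hn ⟨a.out, by ring⟩
    have h3 : ((m * (a.out * n + b.out * w) : Eis) : ℂ) / ((w * n : Eis) : ℂ)
        = ((m * a.out : Eis) : ℂ) / (w : ℂ) + ((m * b.out : Eis) : ℂ) / (n : ℂ) := by
      push_cast; field_simp
    rw [Fg, Fg, Fg, hχ.mul_bot _ _ _ hw hn, h1, h2, h3, eE_add]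
    push_cast
    ring
  · rw [Fintype.bijective_iff_injective_and_card]
    constructor
    · rintro ⟨a, b⟩ ⟨a', b'⟩ h
      simp only [mk_eq_iff] at h
      have h1 : w ∣ (a.out - a'.out) * n := by
        obtain ⟨z, hz⟩ := h
        exact ⟨n * z - (b.out - b'.out), by linear_combination hz⟩
      have h2 : n ∣ (b.out - b'.out) * w := by
        obtain ⟨z, hz⟩ := h
        exact ⟨w * z - (a.out - a'.out), by linear_combination hz⟩
      have h3 := hcop.dvd_of_dvd_mul_right h1
      have h4 := hcop.symm.dvd_of_dvd_mul_right h2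
      rw [← mk_eq_iff, Ideal.Quotient.mk_out, Ideal.Quotient.mk_out] at h3 h4
      rw [h3, h4]
    · rw [Fintype.card_prod, ← Nat.card_eq_fintype_card, ← Nat.card_eq_fintype_card,
        ← Nat.card_eq_fintype_card, card_quot, card_quot, card_quot, NmN_mul]

lemma g₃_twist {χ : Eis → Eis → Eis} (hχ : IsCubicSymbol χ) {n k : Eis} (hn : Pr n)
    (hcop : IsCoprime n k) :
    g₃ χ k n = (starRingEnd ℂ) ((χ n k : Eis) : ℂ) * g₃ χ 1 n := by
  have f2 := finite_quot hn.ne_zero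
  let _ : Fintype (Eis ⧸ Ideal.span {n}) := Fintype.ofFinite _
  have h0 : g₃ χ 1 n = ((χ n k : Eis) : ℂ) * g₃ χ k n := by
    rw [g₃_reindex hχ hn 1 (fun d : Eis ⧸ Ideal.span {n} => k * d.out) ?_]
    · rw [g₃_eq_sum, Finset.mul_sum]
      refine Finset.sum_congr rfl fun a _ => ?_
      rw [Fg, Fg, chi_mul hχ hn, one_mul]
      push_cast
      ring
    · rw [Fintype.bijective_iff_injective_and_card]
      refine ⟨?_, rfl⟩
      intro a b h
      simp only [mk_eq_iff, ← mul_sub] at h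
      have h3 := hcop.dvd_of_dvd_mul_left h
      rwa [← mk_eq_iff, Ideal.Quotient.mk_out, Ideal.Quotient.mk_out] at h3
  have hz := chi_vals hχ hn k
  have h1 := hz.cube ((chi_ne_zero hχ hn).2 hcop)
  have h2 : ((χ n k : Eis) : ℂ) ^ 3 = 1 := by exact_mod_cast congrArg Subtype.val h1
  have h3 : (starRingEnd ℂ) ((χ n k : Eis) : ℂ) = ((χ n k : Eis) : ℂ) ^ 2 := by
    rw [← conjE_coe, hz.conj_eq]; push_cast; rfl
  rw [h3, h0]
  linear_combination -(g₃ χ k n) * h2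

lemma g₃_split {χ : Eis → Eis → Eis} (hχ : IsCubicSymbol χ) {w n k : Eis} (hw : Pr w) (hn : Pr n)
    (hcop : IsCoprime n w) (hk : IsCoprime n k) :
    g₃ χ k (w * n) = g₃ χ k w * ((starRingEnd ℂ) ((χ n (k * w) : Eis) : ℂ) * g₃ χ 1 n) := by
  rw [g₃_mul hχ hw hn hcop.symm, g₃_twist hχ hn hk, recip hχ hw hn]
  have hz := chi_vals hχ hn w
  have h3 : (starRingEnd ℂ) ((χ n w : Eis) : ℂ) = ((χ n w : Eis) : ℂ) ^ 2 := by
    rw [← conjE_coe, hz.conj_eq]; push_cast; rfl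
  rw [chi_mul hχ hn]
  push_cast
  rw [map_mul, h3]
  ring

/-! ### Divisor bound -/

lemma finite_ball (B : ℕ) : {x : Eis | NmN x ≤ B}.Finite := by
  refine Set.Finite.subset (((Set.finite_Icc (-(2 * B : ℤ)) (2 * B)).prod
    (Set.finite_Icc (-(2 * B : ℤ)) (2 * B))).image
      fun p : ℤ × ℤ => ((p.1 : ℤ) : Eis) + ((p.2 : ℤ) : Eis) * ωE) ?_
  intro x hx
  obtain ⟨a, b, rfl⟩ := coords x
  have h := NmN_coords a b
  have hB : a ^ 2 - a * b + b ^ 2 ≤ (B : ℤ) := by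
    rw [← h]; exact_mod_cast hx
  have key : ∀ a b : ℤ, a ^ 2 - a * b + b ^ 2 ≤ (B : ℤ) → -(2 * (B : ℤ)) ≤ a ∧ a ≤ 2 * (B : ℤ) := by
    intro a b h
    have h1 : 3 * a ^ 2 ≤ 4 * (B : ℤ) := by nlinarith [sq_nonneg (a - 2 * b)]
    have h2 : a ≤ a ^ 2 := by
      have := Int.le_self_sq a
      exact this
    have h3 : -a ≤ a ^ 2 := by
      have := Int.le_self_sq (-a)
      nlinarith
    constructor <;> nlinarith
  have h1 := key a b hB
  have h2 := key b a (by linarith)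
  exact ⟨(a, b), ⟨⟨h1.1, h1.2⟩, ⟨h2.1, h2.2⟩⟩, rfl⟩

/-- The set of primary divisors. -/
def Dv (x : Eis) : Set Eis := {w | Pr w ∧ w ∣ x}

lemma Dv_finite {x : Eis} (hx : x ≠ 0) : (Dv x).Finite := by
  refine (finite_ball (NmN x)).subset ?_
  intro w hw
  exact Nat.le_of_dvd (NmN_pos hx) (NmN_dvd hw.2)

lemma Dv_mul_subset (x y : Eis) : Dv (x * y) ⊆ (fun p : Eis × Eis => p.1 * p.2) '' (Dv x ×ˢ Dv y) := by
  rintro w ⟨hw, hd⟩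
  obtain ⟨u, v, hu, hv, rfl⟩ := exists_dvd_and_dvd_of_dvd_mul hd
  have hlu : ¬ lam ∣ u := fun h => hw.not_lam_dvd (h.mul_right v)
  obtain ⟨e, he, heu⟩ := exists_unit_mul_Pr hlu
  obtain ⟨e', he'⟩ := he.exists_left_inv
  have hprod : (e * u) * (e' * v) = u * v := by linear_combination u * v * he'
  refine ⟨(e * u, e' * v), ⟨⟨heu, ?_⟩, ⟨?_, ?_⟩⟩, hprod⟩
  · exact he.mul_left_dvd.2 hu
  · exact heu.of_mul (by rw [hprod]; exact hw)
  · exact (IsUnit.of_mul_eq_one e he').mul_left_dvd.2 hv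

lemma Dv_mul_card {x y : Eis} (hx : x ≠ 0) (hy : y ≠ 0) :
    (Dv (x * y)).ncard ≤ (Dv x).ncard * (Dv y).ncard := by
  have hf := (Dv_finite hx).prod (Dv_finite hy)
  refine (Set.ncard_le_ncard (Dv_mul_subset x y) (hf.image _)).trans ?_
  refine (Set.ncard_image_le hf).trans ?_
  rw [Set.ncard_prod]

lemma Dv_prime_pow {p : Eis} (hp : Prime p) (a : ℕ) : (Dv (p ^ a)).ncard ≤ a + 1 := by
  have h : ∀ w ∈ Dv (p ^ a), ∃ i, i ≤ a ∧ Associated w (p ^ i) := by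
    rintro w ⟨_, hw⟩
    exact (dvd_prime_pow hp a).1 hw
  choose! f hf using h
  have h1 : (Dv (p ^ a)).ncard ≤ (Set.Iio (a + 1)).ncard := by
    refine Set.ncard_le_ncard_of_injOn f ?_ ?_ (Set.finite_Iio _)
    · intro w hw
      exact Nat.lt_succ_of_le (hf w hw).1
    · intro w hw v hv hwv
      refine hw.1.eq_of_associated hv.1 ((hf w hw).2.trans ?_)
      rw [hwv]
      exact (hf v hv).2.symm
  refine h1.trans ?_
  rw [Set.ncard_eq_toFinset_card', Set.toFinset_Iio, Nat.card_Iio]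

lemma Dv_unit {u : Eis} (hu : IsUnit u) : (Dv u).ncard ≤ 1 := by
  rw [Set.ncard_le_one (Dv_finite hu.ne_zero)]
  intro a ha b hb
  apply ha.1.eq_of_associated hb.1
  have h1 := isUnit_of_dvd_unit ha.2 hu
  have h2 := isUnit_of_dvd_unit hb.2 hu
  exact (associated_one_iff_isUnit.2 h1).trans (associated_one_iff_isUnit.2 h2).symm

lemma Nm_pow (x : Eis) (n : ℕ) : Nm (x ^ n) = Nm x ^ n := by
  induction n with
  | zero => simp [Nm]
  | succ n ih => rw [pow_succ, Nm_mul, ih, pow_succ]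

theorem divisor_bound (δ : ℝ) (hδ : 0 < δ) :
    ∃ K : ℝ, 0 ≤ K ∧ ∀ x : Eis, x ≠ 0 → ((Dv x).ncard : ℝ) ≤ K * Nm x ^ δ := by
  classical
  obtain ⟨B, hB⟩ := exists_nat_gt ((2 : ℝ) ^ (1 / δ))
  set r : ℝ := (2 : ℝ) ^ δ with hr
  have hr1 : 1 < r := Real.one_lt_rpow (by norm_num) hδ
  set C₁ : ℝ := 1 + 1 / (r - 1) with hC₁
  have hC1 : 1 ≤ C₁ := by
    have : 0 ≤ 1 / (r - 1) := div_nonneg zero_le_one (by linarith)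
    linarith
  let S : Finset Eis := (finite_ball B).toFinset.filter Prime
  let s : Eis → Finset Eis := fun x => S.filter (fun p => p ∣ x)
  have main : ∀ x : Eis, x ≠ 0 → ((Dv x).ncard : ℝ) ≤ C₁ ^ (s x).card * Nm x ^ δ := by
    intro x
    refine UniqueFactorizationMonoid.induction_on_coprime
      (P := fun x => x ≠ 0 → ((Dv x).ncard : ℝ) ≤ C₁ ^ (s x).card * Nm x ^ δ) x ?_ ?_ ?_ ?_
    · intro h; exact absurd rfl h
    · intro u hu _
      have h1 : ((Dv u).ncard : ℝ) ≤ 1 := by exact_mod_cast Dv_unit hu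
      have h2 : Nm u = 1 := by rw [← NmN_cast, isUnit_iff_NmN.1 hu, Nat.cast_one]
      rw [h2, Real.one_rpow, mul_one]
      exact h1.trans (one_le_pow₀ hC1)
    · intro p i hp _
      have h1 : ((Dv (p ^ i)).ncard : ℝ) ≤ i + 1 := by exact_mod_cast Dv_prime_pow hp i
      refine h1.trans ?_
      have hp0 : 0 ≤ Nm p := Nm_nonneg p
      have hpow : Nm (p ^ i) ^ δ = (Nm p ^ δ) ^ i := by
        rw [Nm_pow, ← Real.rpow_natCast, ← Real.rpow_natCast, ← Real.rpow_mul hp0,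
          ← Real.rpow_mul hp0, mul_comm]
      rw [hpow]
      have hp2 : (2 : ℝ) ≤ Nm p := by
        rw [← NmN_cast]; exact_mod_cast prime_one_lt_NmN hp
      rcases Nat.eq_zero_or_pos i with rfl | hi
      · simp only [Nat.cast_zero, zero_add, pow_zero, mul_one]
        exact one_le_pow₀ hC1
      by_cases hpB : NmN p ≤ B
      · have hmem : p ∈ s (p ^ i) := by
          simp only [s, S, Finset.mem_filter, Set.Finite.mem_toFinset, Set.mem_ofPred_eq]
          exact ⟨⟨hpB, hp⟩, dvd_pow_self p hi.ne'⟩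
        have hcard : (s (p ^ i)).card ≠ 0 := Finset.card_ne_zero_of_mem hmem
        have h3 : C₁ ≤ C₁ ^ (s (p ^ i)).card := le_self_pow₀ hC1 hcard
        have h4 : r ^ i ≤ (Nm p ^ δ) ^ i :=
          pow_le_pow_left₀ (by linarith) (Real.rpow_le_rpow (by norm_num) hp2 hδ.le) i
        have h5 : 1 + (i : ℝ) * (r - 1) ≤ r ^ i := by
          have := one_add_mul_le_pow (a := r - 1) (by linarith) i
          rwa [add_sub_cancel] at this
        have h6 : (i : ℝ) + 1 ≤ C₁ * (1 + (i : ℝ) * (r - 1)) := by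
          have hne : r - 1 ≠ 0 := by linarith
          have h7 : 0 ≤ 1 / (r - 1) := div_nonneg zero_le_one (by linarith)
          have h8 : C₁ * (1 + (i : ℝ) * (r - 1)) = 1 + i * (r - 1) + 1 / (r - 1) + i := by
            rw [hC₁]; field_simp; ring
          have h9 : 0 ≤ (i : ℝ) * (r - 1) := mul_nonneg (Nat.cast_nonneg i) (by linarith)
          rw [h8]; linarith
        calc (i : ℝ) + 1 ≤ C₁ * (1 + (i : ℝ) * (r - 1)) := h6
          _ ≤ C₁ * r ^ i := by gcongr
          _ ≤ C₁ ^ (s (p ^ i)).card * (Nm p ^ δ) ^ i := by gcongr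
      · push Not at hpB
        have h2 : (2 : ℝ) ≤ Nm p ^ δ := by
          have h3 : (2 : ℝ) ^ (1 / δ) ≤ Nm p := by
            rw [← NmN_cast]
            refine hB.le.trans ?_
            exact_mod_cast hpB.le
          have h4 := Real.rpow_le_rpow (by positivity) h3 hδ.le
          rwa [← Real.rpow_mul (by norm_num), one_div, inv_mul_cancel₀ hδ.ne', Real.rpow_one] at h4
        have h5 : (i : ℝ) + 1 ≤ 2 ^ i := by
          have : i + 1 ≤ 2 ^ i := Nat.lt_two_pow_self
          exact_mod_cast this
        calc (i : ℝ) + 1 ≤ 1 * 2 ^ i := by rw [one_mul]; exact h5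
          _ ≤ C₁ ^ (s (p ^ i)).card * (Nm p ^ δ) ^ i := by
            gcongr
            exact one_le_pow₀ hC1
    · intro x y hxy hx hy h0
      have hx0 := left_ne_zero_of_mul h0
      have hy0 := right_ne_zero_of_mul h0
      have h1 : ((Dv (x * y)).ncard : ℝ) ≤ (Dv x).ncard * (Dv y).ncard := by
        exact_mod_cast Dv_mul_card hx0 hy0
      have h2 : (s x).card + (s y).card ≤ (s (x * y)).card := by
        rw [← Finset.card_union_of_disjoint]
        · apply Finset.card_le_card
          intro p hp
          simp only [s, Finset.mem_union, Finset.mem_filter] at hp ⊢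
          rcases hp with hp | hp
          · exact ⟨hp.1, hp.2.mul_right y⟩
          · exact ⟨hp.1, hp.2.mul_left x⟩
        · rw [Finset.disjoint_left]
          intro p hp hp'
          simp only [s, S, Finset.mem_filter] at hp hp'
          exact hp.1.2.not_isUnit (hxy hp.2 hp'.2)
      have h3 : Nm (x * y) ^ δ = Nm x ^ δ * Nm y ^ δ := by
        rw [Nm_mul, Real.mul_rpow (Nm_nonneg x) (Nm_nonneg y)]
      calc ((Dv (x * y)).ncard : ℝ) ≤ (Dv x).ncard * (Dv y).ncard := h1
        _ ≤ (C₁ ^ (s x).card * Nm x ^ δ) * (C₁ ^ (s y).card * Nm y ^ δ) := by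
          gcongr
          · exact mul_nonneg (by positivity) (Real.rpow_nonneg (Nm_nonneg x) _)
          · exact hx hx0
          · exact hy hy0
        _ = C₁ ^ ((s x).card + (s y).card) * Nm (x * y) ^ δ := by rw [h3, pow_add]; ring
        _ ≤ _ := by
          have := Real.rpow_nonneg (Nm_nonneg (x * y)) δ
          gcongr
  refine ⟨C₁ ^ S.card, by positivity, fun x hx => (main x hx).trans ?_⟩
  have := Real.rpow_nonneg (Nm_nonneg x) δ
  gcongr
  exact Finset.filter_subset _ _

/-! ### The splitting -/

lemma exists_split (k : Eis) {c : Eis} (hc : Pr c) :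
    ∃ w n : Eis, Pr w ∧ Pr n ∧ c = w * n ∧ (∀ p, Prime p → p ∣ w → p ∣ k) ∧ IsCoprime n k := by
  refine pr_induction (P := fun c => ∃ w n : Eis, Pr w ∧ Pr n ∧ c = w * n ∧
    (∀ p, Prime p → p ∣ w → p ∣ k) ∧ IsCoprime n k) ?_ ?_ c hc
  · refine ⟨1, 1, Pr_one, Pr_one, (mul_one 1).symm, ?_, isCoprime_one_left⟩
    intro p hp h
    exact absurd (isUnit_of_dvd_one h) hp.not_isUnit
  · rintro π b hπ hpπ hb ⟨w, n, hw, hn, rfl, hwk, hnk⟩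
    by_cases h : π ∣ k
    · refine ⟨π * w, n, hpπ.mul hw, hn, by ring, ?_, hnk⟩
      intro p hp hd
      rcases hp.dvd_or_dvd hd with h1 | h1
      · exact h1.trans h
      · exact hwk p hp h1
    · refine ⟨w, π * n, hw, hpπ.mul hn, by ring, hwk, ?_⟩
      exact (hπ.irreducible.coprime_iff_not_dvd.2 h).mul_left hnk

lemma mu_sq {μ : Eis → ℤ} (hμ : IsMoebius μ) {n : Eis} (hn : Pr n) (hs : Squarefree n) :
    μ n = 1 ∨ μ n = -1 := by
  refine pr_induction (P := fun n => Squarefree n → μ n = 1 ∨ μ n = -1) ?_ ?_ n hn hs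
  · intro _; exact Or.inl (hμ.isUnit 1 isUnit_one)
  · intro π b hπ _ _ ih hs
    have h1 : ¬ π ∣ b := fun h => hπ.not_isUnit (hs π (mul_dvd_mul_left π h))
    rw [hμ.prime_mul π b hπ h1]
    rcases ih (hs.squarefree_of_dvd (Dvd.intro_left π rfl)) with h | h
    · right; rw [h]
    · left; rw [h]; norm_num

lemma g₃_zero_of_not_squarefree {χ : Eis → Eis → Eis} (hχ : IsCubicSymbol χ) {w n k : Eis}
    (hw : Pr w) (hn : Pr n) (hk : IsCoprime n k) (hs : ¬ Squarefree n) : g₃ χ k (w * n) = 0 := by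
  by_contra h0
  rw [Squarefree] at hs
  push Not at hs
  obtain ⟨x, ⟨m, hm⟩, hx⟩ := hs
  have hn0 := hn.ne_zero
  have h1 := g₃_shift hχ (hw.mul hn) (m := k) (e := w * (x * m)) ?_ h0
  · have hx0 : w * (x * m) ≠ 0 := by
      refine mul_ne_zero hw.ne_zero ?_
      intro h
      apply hn0
      rw [hm, mul_assoc, h, mul_zero]
    have h2 : x * (w * (x * m)) ∣ k * (w * (x * m)) := by
      have : x * (w * (x * m)) = w * n := by rw [hm]; ring
      rw [this]; exact h1
    have h3 : x ∣ k := (mul_dvd_mul_iff_right hx0).1 h2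
    exact hx (hk.isUnit_of_dvd' ⟨x * m, by rw [hm]; ring⟩ h3)
  · intro p hp hd
    rcases hp.dvd_or_dvd hd with h | h
    · exact h.mul_right _
    · rw [hm, mul_assoc] at h
      rcases hp.dvd_or_dvd h with h | h
      · exact (h.mul_right m).mul_left w
      · exact h.mul_left w

lemma w_dvd_of_ne_zero {χ : Eis → Eis → Eis} (hχ : IsCubicSymbol χ) {w n k : Eis}
    (hw : Pr w) (hn : Pr n) (hwk : ∀ p, Prime p → p ∣ w → p ∣ k) (h0 : g₃ χ k (w * n) ≠ 0) :
    w ∣ k ^ 2 := by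
  have h1 := g₃_shift hχ (hw.mul hn) (m := k) (e := k * n) ?_ h0
  · rw [← mul_assoc, ← pow_two] at h1
    exact (mul_dvd_mul_iff_right hn.ne_zero).1 h1
  · intro p hp hd
    rcases hp.dvd_or_dvd hd with h | h
    · exact (hwk p hp h).mul_right n
    · exact h.mul_left k

/-- Term of the left-hand sum. -/
def fL (χ : Eis → Eis → Eis) (k : Eis) (s : ℂ) (H : ℝ → ℝ) (C₀ : ℝ) (c : Eis) : ℂ :=
  g₃ χ k c * (Nm c : ℂ) ^ (-s) * ((H (Nm c / C₀) : ℝ) : ℂ)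

/-- Term of the right-hand inner sum. -/
def fR (χ : Eis → Eis → Eis) (μ : Eis → ℤ) (k w : Eis) (s : ℂ) (H : ℝ → ℝ) (C₀ : ℝ)
    (n : Eis) : ℂ :=
  ((μ n : ℂ)) ^ 2 * (starRingEnd ℂ) ((χ n (k * w) : Eis) : ℂ) *
    g₃ χ 1 n * (Nm n : ℂ) ^ (-s) * ((H (Nm (w * n) / C₀) : ℝ) : ℂ)

lemma fL_mul {χ : Eis → Eis → Eis} (hχ : IsCubicSymbol χ) {μ : Eis → ℤ} (hμ : IsMoebius μ)
    {k w n : Eis} (s : ℂ) (H : ℝ → ℝ) (C₀ : ℝ) (hw : Pr w) (hwk : w ∣ k ^ 2) (hn : Pr n)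
    (hnk : IsCoprime n k) :
    fL χ k s H C₀ (w * n) = (g₃ χ k w * (Nm w : ℂ) ^ (-s)) * fR χ μ k w s H C₀ n := by
  have hcop : IsCoprime n w := (hnk.pow_right (n := 2)).of_isCoprime_of_dvd_right hwk
  by_cases hs : Squarefree n
  · have hm : ((μ n : ℂ)) ^ 2 = 1 := by
      rcases mu_sq hμ hn hs with h | h <;> rw [h] <;> norm_num
    rw [fL, fR, hm, g₃_split hχ hw hn hcop hnk, Nm_mul, Complex.ofReal_mul,
      Complex.mul_cpow_ofReal_nonneg (Nm_nonneg w) (Nm_nonneg n)]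
    ring
  · rw [fL, fR, g₃_zero_of_not_squarefree hχ hw hn hnk hs, hμ.eq_zero n hs]
    simp

lemma fL_tsum {χ : Eis → Eis → Eis} (hχ : IsCubicSymbol χ) {μ : Eis → ℤ} (hμ : IsMoebius μ)
    {k : Eis} (hk : k ≠ 0) (s : ℂ) (H : ℝ → ℝ) (C₀ : ℝ)
    (hsum : Summable fun c : {c : Eis // (3 : Eis) ∣ (c - 1)} => fL χ k s H C₀ c.1) :
    ∑' c : {c : Eis // (3 : Eis) ∣ (c - 1)}, fL χ k s H C₀ c.1
      = ∑ w ∈ (Dv_finite (pow_ne_zero 2 hk)).toFinset, (g₃ χ k w * (Nm w : ℂ) ^ (-s)) *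
          ∑' n : {n : Eis // (3 : Eis) ∣ (n - 1)}, fR χ μ k w s H C₀ n.1 := by
  set W := (Dv_finite (pow_ne_zero 2 hk)).toFinset with hW
  have hWm : ∀ w : W, Pr w.1 ∧ w.1 ∣ k ^ 2 := by
    rintro ⟨w, hw⟩
    rw [hW, Set.Finite.mem_toFinset] at hw
    exact hw
  let N := {n : Eis // Pr n ∧ IsCoprime n k}
  let i : W × N → {c : Eis // (3 : Eis) ∣ (c - 1)} :=
    fun p => ⟨p.1.1 * p.2.1, (hWm p.1).1.mul p.2.2.1⟩
  have hcop : ∀ (w : W) (n : N), IsCoprime n.1 w.1 := fun w n =>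
    (n.2.2.pow_right (n := 2)).of_isCoprime_of_dvd_right (hWm w).2
  have hinj : Function.Injective i := by
    rintro ⟨w, n⟩ ⟨w', n'⟩ h
    have h1 : w.1 * n.1 = w'.1 * n'.1 := congrArg Subtype.val h
    have h2 : w.1 ∣ w'.1 := (hcop w n').symm.dvd_of_dvd_mul_right ⟨n.1, h1.symm⟩
    have h3 : w'.1 ∣ w.1 := (hcop w' n).symm.dvd_of_dvd_mul_right ⟨n'.1, h1⟩
    have h4 : w.1 = w'.1 := (hWm w).1.eq_of_associated (hWm w').1 (associated_of_dvd_dvd h2 h3)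
    have h5 : n.1 = n'.1 := by
      rw [← h4] at h1
      exact mul_left_cancel₀ (hWm w).1.ne_zero h1
    exact Prod.ext (Subtype.ext h4) (Subtype.ext h5)
  have hsupp : Function.support (fun c : {c : Eis // (3 : Eis) ∣ (c - 1)} => fL χ k s H C₀ c.1)
      ⊆ Set.range i := by
    rintro ⟨c, hc⟩ h
    rw [Function.mem_support] at h
    have h0 : g₃ χ k c ≠ 0 := by
      intro h1
      apply h
      simp only [fL, h1, zero_mul]
    obtain ⟨w, n, hw, hn, rfl, hwk, hnk⟩ := exists_split k hc
    have hd := w_dvd_of_ne_zero hχ hw hn hwk h0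
    refine ⟨(⟨w, ?_⟩, ⟨n, hn, hnk⟩), rfl⟩
    rw [hW, Set.Finite.mem_toFinset]
    exact ⟨hw, hd⟩
  have hsum2 : Summable fun p : W × N => fL χ k s H C₀ (i p).1 := hsum.comp_injective hinj
  rw [← hinj.tsum_eq hsupp, hsum2.tsum_prod, tsum_fintype, ← Finset.sum_coe_sort W]
  refine Finset.sum_congr rfl fun w _ => ?_
  rw [← tsum_mul_left]
  let j : N → {n : Eis // (3 : Eis) ∣ (n - 1)} := fun n => ⟨n.1, n.2.1⟩
  have hj : Function.Injective j := fun a b h =>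
    Subtype.ext (show (j a).1 = (j b).1 by rw [h])
  rw [← hj.tsum_eq]
  · refine tsum_congr fun n => ?_
    exact fL_mul hχ hμ s H C₀ (hWm w).1 (hWm w).2 n.2.1 n.2.2
  · rintro ⟨n, hn⟩ h
    rw [Function.mem_support] at h
    have h0 : χ n (k * w.1) ≠ 0 := by
      intro h1
      apply h
      simp [fR, h1]
    have h2 := (chi_ne_zero hχ hn).1 h0
    exact ⟨⟨n, hn, h2.of_mul_right_left⟩, rfl⟩

lemma weight_le {χ : Eis → Eis → Eis} (hχ : IsCubicSymbol χ) {k w : Eis} (hw : Pr w)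
    (σ t : ℝ) (A : ℂ) :
    ‖(g₃ χ k w * (Nm w : ℂ) ^ (-((σ : ℂ) + t * Complex.I))) * A‖ ^ 2
      ≤ Nm w ^ (2 - 2 * σ) * ‖A‖ ^ 2 := by
  have hp := Nm_pos hw.ne_zero
  rw [norm_mul, mul_pow]
  refine mul_le_mul_of_nonneg_right ?_ (by positivity)
  rw [norm_mul, Complex.norm_cpow_eq_rpow_re_of_pos hp]
  have hre : (-((σ : ℂ) + t * Complex.I)).re = -σ := by simp
  rw [hre]
  have h1 : ‖g₃ χ k w‖ * Nm w ^ (-σ) ≤ Nm w ^ (1 - σ) := by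
    rw [sub_eq_add_neg, Real.rpow_add hp, Real.rpow_one]
    exact mul_le_mul_of_nonneg_right (g₃_norm_le hχ hw k) (Real.rpow_nonneg hp.le _)
  have h2 : Nm w ^ (2 - 2 * σ) = (Nm w ^ (1 - σ)) ^ 2 := by
    rw [← Real.rpow_natCast, ← Real.rpow_mul hp.le]
    congr 1; push_cast; ring
  rw [h2]
  exact pow_le_pow_left₀ (mul_nonneg (norm_nonneg _) (Real.rpow_nonneg hp.le _)) h1 2

/-- Lemma 6.4: splitting off the part of `k` shared with the modulus,
`|∑_{c ≡ 1(3)} g₃(k,c) N(c)^{-σ-it} H(N(c)/C)|² ≪_ε N(k)^ε ∑_{w ∣ k², w ≡ 1(3)}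
N(w)^{2-2σ} |∑_{n ≡ 1(3)} μ(n)² conj(χ_n(kw)) g₃(n) N(n)^{-σ-it} H(N(wn)/C)|²`. -/
theorem gauss_sum_split_bound (ε : ℝ) (hε : 0 < ε) :
    ∃ C : ℝ, ∀ (χ : Eis → Eis → Eis), IsCubicSymbol χ →
      ∀ (μ : Eis → ℤ), IsMoebius μ →
      ∀ (H : SchwartzMap ℝ ℝ) (k : Eis), k ≠ 0 → ∀ (t σ C₀ : ℝ), 1 ≤ σ → 0 < C₀ →
        ‖∑' c : {c : Eis // (3 : Eis) ∣ (c - 1)},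
            g₃ χ k c.1 * (Nm c.1 : ℂ) ^ (-((σ : ℂ) + t * Complex.I)) *
              ((H (Nm c.1 / C₀) : ℝ) : ℂ)‖ ^ 2
          ≤ C * Nm k ^ ε *
            ∑ᶠ w ∈ {w : Eis | (3 : Eis) ∣ (w - 1) ∧ w ∣ k ^ 2},
              Nm w ^ (2 - 2 * σ) *
                ‖∑' n : {n : Eis // (3 : Eis) ∣ (n - 1)},
                    ((μ n.1 : ℂ)) ^ 2 * (starRingEnd ℂ) ((χ n.1 (k * w) : Eis) : ℂ) *
                      g₃ χ 1 n.1 * (Nm n.1 : ℂ) ^ (-((σ : ℂ) + t * Complex.I)) *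
                      ((H (Nm (w * n.1) / C₀) : ℝ) : ℂ)‖ ^ 2 := by
  obtain ⟨K, hK0, hK⟩ := divisor_bound (ε / 2) (by linarith)
  refine ⟨K, ?_⟩
  intro χ hχ μ hμ H k hk t σ C₀ _ _
  have hk2 : k ^ 2 ≠ 0 := pow_ne_zero 2 hk
  set s : ℂ := (σ : ℂ) + t * Complex.I with hs
  have hset : {w : Eis | (3 : Eis) ∣ (w - 1) ∧ w ∣ k ^ 2} = Dv (k ^ 2) := rfl
  rw [hset, finsum_mem_eq_finite_toFinset_sum _ (Dv_finite hk2)]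
  set W := (Dv_finite hk2).toFinset with hW
  change ‖∑' c : {c : Eis // (3 : Eis) ∣ (c - 1)}, fL χ k s H C₀ c.1‖ ^ 2 ≤ K * Nm k ^ ε *
    ∑ w ∈ W, Nm w ^ (2 - 2 * σ) *
      ‖∑' n : {n : Eis // (3 : Eis) ∣ (n - 1)}, fR χ μ k w s H C₀ n.1‖ ^ 2
  have hS0 : 0 ≤ ∑ w ∈ W, Nm w ^ (2 - 2 * σ) *
      ‖∑' n : {n : Eis // (3 : Eis) ∣ (n - 1)}, fR χ μ k w s H C₀ n.1‖ ^ 2 :=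
    Finset.sum_nonneg fun w _ => mul_nonneg (Real.rpow_nonneg (Nm_nonneg w) _) (by positivity)
  by_cases hsum : Summable fun c : {c : Eis // (3 : Eis) ∣ (c - 1)} => fL χ k s H C₀ c.1
  swap
  · rw [tsum_eq_zero_of_not_summable hsum, norm_zero, zero_pow two_ne_zero]
    exact mul_nonneg (mul_nonneg hK0 (Real.rpow_nonneg (Nm_nonneg k) _)) hS0
  rw [fL_tsum hχ hμ hk s H C₀ hsum]
  have hcard : (W.card : ℝ) ≤ K * Nm k ^ ε := by
    have h1 := hK (k ^ 2) hk2
    rw [Set.ncard_eq_toFinset_card _ (Dv_finite hk2), Nm_pow, ← Real.rpow_natCast,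
      ← Real.rpow_mul (Nm_nonneg k)] at h1
    rwa [show ((2 : ℕ) : ℝ) * (ε / 2) = ε by push_cast; ring] at h1
  refine le_trans ?_ (mul_le_mul_of_nonneg_right hcard hS0)
  refine (pow_le_pow_left₀ (norm_nonneg _) (norm_sum_le _ _) 2).trans ?_
  refine sq_sum_le_card_mul_sum_sq.trans ?_
  refine mul_le_mul_of_nonneg_left ?_ (Nat.cast_nonneg _)
  refine Finset.sum_le_sum fun w hw => ?_
  rw [Set.Finite.mem_toFinset] at hw
  exact weight_le hχ hw.1 σ t _

end CubicPaper
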